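/- arXiv:1508.04804 — 10 statements merged into one kernel-verified Lean document; each statement's English description precedes it below -/
import Mathlib

section
/- Let X be a nondegenerate generalized gamma convolution (GGC) with Thorin measure μ whose Thorin mass D = μ((0,∞)) satisfies 0 < D < ∞, and let φ(s) = E[exp(−sX)] denote its Laplace transform. Then φ is regularly varying at infinity with variation exponent −D: for every t > 0, lim_{ρ→∞} φ(tρ)/φ(ρ) = t^(−D). -/
open MeasureTheory Real Set Filter

/-- `X` (a nonnegative random variable on `(Ω, P)`) is a generalized gamma convolution
with Thorin measure `μ` (a nonnegative Borel measure on `(0,∞)`). -/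
def IsGGC {Ω : Type*} [MeasurableSpace Ω] (P : Measure Ω) (X : Ω → ℝ)
    (μ : Measure ℝ) : Prop :=
  (∀ ω, 0 ≤ X ω) ∧
  (∀ s : ℝ, 0 ≤ s → IntegrableOn (fun u => Real.log (1 + s / u)) (Set.Ioi 0) μ) ∧
  (∀ s : ℝ, 0 ≤ s →
    ∫ ω, Real.exp (-(s * X ω)) ∂P =
      Real.exp (-(∫ u in Set.Ioi (0:ℝ), Real.log (1 + s / u) ∂μ)))

/-- The increment of `log (1 + · / u)` between `ρ` and `t ρ` is bounded by `|log t|`. -/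
lemma abs_log_one_add_mul_div_sub_le {t ρ u : ℝ} (ht : 0 < t) (hρ : 0 < ρ) (hu : 0 < u) :
    |Real.log (1 + t * ρ / u) - Real.log (1 + ρ / u)| ≤ |Real.log t| := by
  have hx : 0 < ρ / u := div_pos hρ hu
  rw [mul_div_assoc]
  generalize ρ / u = x at hx
  have htx : 0 < t * x := mul_pos ht hx
  have hlog : Real.log (t * (1 + x)) = Real.log t + Real.log (1 + x) :=
    Real.log_mul ht.ne' (by positivity)
  rcases le_total 1 t with h | h
  · have h₁ : Real.log (1 + x) ≤ Real.log (1 + t * x) :=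
      Real.log_le_log (by positivity) (by nlinarith)
    have h₂ : Real.log (1 + t * x) ≤ Real.log (t * (1 + x)) :=
      Real.log_le_log (by positivity) (by nlinarith)
    rw [abs_of_nonneg (by linarith), abs_of_nonneg (Real.log_nonneg h)]
    linarith
  · have h₁ : Real.log (1 + t * x) ≤ Real.log (1 + x) :=
      Real.log_le_log (by positivity) (by nlinarith)
    have h₂ : Real.log (t * (1 + x)) ≤ Real.log (1 + t * x) :=
      Real.log_le_log (by positivity) (by nlinarith)
    rw [abs_of_nonpos (by linarith), abs_of_nonpos (Real.log_nonpos ht.le h)]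
    linarith

lemma tendsto_log_one_add_mul_div_sub {t u : ℝ} (ht : 0 < t) (hu : 0 < u) :
    Tendsto (fun ρ : ℝ => Real.log (1 + t * ρ / u) - Real.log (1 + ρ / u))
      atTop (nhds (Real.log t)) := by
  have hden : Tendsto (fun ρ : ℝ => 1 + ρ / u) atTop atTop :=
    tendsto_atTop_add_const_left _ _ (tendsto_id.atTop_div_const hu)
  have hquot : Tendsto (fun ρ : ℝ => t + (1 - t) / (1 + ρ / u)) atTop (nhds t) := by
    simpa using (tendsto_const_nhds (x := t)).add (hden.const_div_atTop (1 - t))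
  refine (hquot.log ht.ne').congr' ?_
  filter_upwards [eventually_gt_atTop 0] with ρ hρ
  have h₁ : 0 < 1 + ρ / u := by positivity
  have h₂ : 0 < 1 + t * ρ / u := by positivity
  rw [← Real.log_div h₂.ne' h₁.ne']
  congr 1
  field_simp
  ring

/-- The Laplace transform of a nondegenerate GGC with finite positive Thorin mass `D` is
regularly varying at infinity with variation exponent `-D`:
`lim_{ρ→∞} φ(tρ)/φ(ρ) = t^(-D)` for every `t > 0`. -/
theorem ggc_laplaceTransform_regularlyVarying {Ω : Type*} [MeasurableSpace Ω]
    (P : Measure Ω) [IsProbabilityMeasure P] (X : Ω → ℝ) (hX : Measurable X)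
    (μ : Measure ℝ) (hGGC : IsGGC P X μ)
    (hfin : μ (Set.Ioi (0:ℝ)) ≠ ⊤)
    (D : ℝ) (hD : D = (μ (Set.Ioi (0:ℝ))).toReal) (hDpos : 0 < D) :
    ∀ t : ℝ, 0 < t →
      Tendsto (fun ρ : ℝ =>
          (∫ ω, Real.exp (-(t * ρ * X ω)) ∂P) / (∫ ω, Real.exp (-(ρ * X ω)) ∂P))
        atTop (nhds (t ^ (-D))) := by
  intro t ht
  obtain ⟨-, hint, hlap⟩ := hGGC
  have : IsFiniteMeasure (μ.restrict (Set.Ioi (0 : ℝ))) :=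
    isFiniteMeasure_restrict.mpr hfin
  have hlim : Tendsto (fun ρ : ℝ => ∫ u in Set.Ioi (0 : ℝ),
      (Real.log (1 + t * ρ / u) - Real.log (1 + ρ / u)) ∂μ)
      atTop (nhds (∫ _ in Set.Ioi (0 : ℝ), Real.log t ∂μ)) := by
    refine tendsto_integral_filter_of_dominated_convergence (fun _ => |Real.log t|)
      ?_ ?_ (integrable_const _) ?_
    · filter_upwards [eventually_gt_atTop 0] with ρ hρ
      exact ((hint _ (mul_pos ht hρ).le).sub (hint _ hρ.le)).aestronglyMeasurable
    · filter_upwards [eventually_gt_atTop 0] with ρ hρ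
      filter_upwards [ae_restrict_mem measurableSet_Ioi] with u hu
      exact abs_log_one_add_mul_div_sub_le ht hρ hu
    · filter_upwards [ae_restrict_mem measurableSet_Ioi] with u hu
      exact tendsto_log_one_add_mul_div_sub ht hu
  have hconst : ∫ _ in Set.Ioi (0 : ℝ), Real.log t ∂μ = Real.log t * D := by
    rw [setIntegral_const, smul_eq_mul, hD, Measure.real, mul_comm]
  rw [Real.rpow_def_of_pos ht, mul_neg, ← hconst]
  refine (hlim.neg.rexp).congr' ?_
  filter_upwards [eventually_gt_atTop 0] with ρ hρ
  have hρt := (mul_pos ht hρ).le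
  rw [hlap _ hρt, hlap _ hρ.le, ← Real.exp_sub, integral_sub (hint _ hρt) (hint _ hρ.le)]
  congr 1
  ring
end

section
/- Let X be a generalized gamma convolution (GGC) with Thorin measure μ whose Thorin mass D = μ((0,∞)) satisfies 0 < D < ∞ and which satisfies ∫₀^∞ |log u| μ(du) < ∞. Then the average symbol error rate of DPSK over the corresponding fading channel, P̄(ρ) = (1/2)·E[exp(−ρX)], satisfies lim_{ρ→∞} ρ^D · P̄(ρ) = (1/2)·exp(∫₀^∞ (log u) μ(du)); i.e., the asymptotic SER decays polynomially with exponent equal to the Thorin mass, with array gain determined by ∫₀^∞ (log u) μ(du). -/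
open MeasureTheory Real Set Filter

/-- The logarithmic integral `∫ log (1 + u / s) dν` of a finite measure with integrable `|log|`
vanishes in the limit `s → ∞`. -/
theorem tendsto_integral_log_one_add_div (ν : Measure ℝ) [IsFiniteMeasure ν]
    (hpos : ∀ᵐ u ∂ν, 0 < u) (hlog : Integrable (fun u => |Real.log u|) ν) :
    Tendsto (fun s : ℝ => ∫ u, Real.log (1 + u / s) ∂ν) atTop (nhds 0) := by
  rw [← integral_zero ℝ ℝ (μ := ν)]
  refine tendsto_integral_filter_of_dominated_convergence
    (fun u => Real.log 2 + |Real.log u|) ?_ ?_ ((integrable_const _).add hlog) ?_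
  · exact Eventually.of_forall fun s => Measurable.aestronglyMeasurable (by fun_prop)
  · filter_upwards [eventually_ge_atTop 1] with s hs
    filter_upwards [hpos] with u hu
    have hdiv : u / s ≤ u := div_le_self hu.le hs
    have hdiv_nonneg : 0 ≤ u / s := by positivity
    rw [Real.norm_of_nonneg (Real.log_nonneg (by linarith))]
    rcases le_total u 1 with h | h
    · have := Real.log_le_log (by positivity) (show 1 + u / s ≤ 2 by linarith)
      linarith [abs_nonneg (Real.log u)]
    · have := Real.log_le_log (by positivity) (show 1 + u / s ≤ 2 * u by linarith)
      rw [Real.log_mul two_ne_zero hu.ne'] at this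
      linarith [le_abs_self (Real.log u)]
  · refine Eventually.of_forall fun u => ?_
    have h : Tendsto (fun s : ℝ => 1 + u / s) atTop (nhds 1) := by
      simpa using tendsto_const_nhds.add (tendsto_id.const_div_atTop u)
    simpa using h.log one_ne_zero

/-- For a GGC fading channel with finite positive Thorin mass `D` satisfying
`∫₀^∞ |log u| μ(du) < ∞`, the average SER of DPSK `P̄(ρ) = (1/2) E[exp(-ρX)]` satisfies
`lim_{ρ→∞} ρ^D P̄(ρ) = (1/2) exp (∫₀^∞ (log u) μ(du))`. -/
theorem ggc_dpsk_asymptotic_ser {Ω : Type*} [MeasurableSpace Ω]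
    (P : Measure Ω) [IsProbabilityMeasure P] (X : Ω → ℝ) (hX : Measurable X)
    (μ : Measure ℝ) (hGGC : IsGGC P X μ)
    (hfin : μ (Set.Ioi (0:ℝ)) ≠ ⊤)
    (D : ℝ) (hD : D = (μ (Set.Ioi (0:ℝ))).toReal) (hDpos : 0 < D)
    (hlog : IntegrableOn (fun u => |Real.log u|) (Set.Ioi 0) μ) :
    Tendsto (fun ρ : ℝ => ρ ^ D * ((1/2) * ∫ ω, Real.exp (-(ρ * X ω)) ∂P))
      atTop (nhds ((1/2) * Real.exp (∫ u in Set.Ioi (0:ℝ), Real.log u ∂μ))) := by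
  obtain ⟨-, hint, hLaplace⟩ := hGGC
  set ν := μ.restrict (Set.Ioi (0:ℝ)) with hν
  have : IsFiniteMeasure ν := isFiniteMeasure_restrict.mpr hfin
  have hpos : ∀ᵐ u ∂ν, 0 < u := ae_restrict_mem measurableSet_Ioi
  have hlog_int : Integrable Real.log ν :=
    (integrable_norm_iff Real.measurable_log.aestronglyMeasurable).mp hlog
  have hlim := (((tendsto_const_nhds (x := ∫ u, Real.log u ∂ν)).sub
    (tendsto_integral_log_one_add_div ν hpos hlog)).rexp).const_mul (1 / 2)
  rw [sub_zero] at hlim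
  refine hlim.congr' ?_
  filter_upwards [eventually_gt_atTop 0] with s hs
  have hsplit : ∀ᵐ u ∂ν,
      Real.log (1 + u / s) = Real.log (1 + s / u) + (Real.log u - Real.log s) := by
    filter_upwards [hpos] with u hu
    rw [← Real.log_div hu.ne' hs.ne', ← Real.log_mul (by positivity) (by positivity)]
    congr 1
    field_simp
    ring
  have hconst : ∫ _, Real.log s ∂ν = D * Real.log s := by
    simp [hD, hν, Measure.real]
  have hint_s : Integrable (fun u => Real.log (1 + s / u)) ν := hint s hs.le
  have hdiff : Integrable (fun u => Real.log u - Real.log s) ν :=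
    hlog_int.sub (integrable_const _)
  rw [hLaplace s hs.le, integral_congr_ae hsplit, integral_add hint_s hdiff,
    integral_sub hlog_int (integrable_const _), hconst, Real.rpow_def_of_pos hs,
    mul_left_comm, ← Real.exp_add]
  congr 2
  ring
end

section
/- Let X be a nondegenerate generalized gamma convolution (GGC) with Thorin measure μ whose Thorin mass D = μ((0,∞)) satisfies 0 < D < ∞. Then the diversity order of DPSK over the corresponding fading channel equals D: the average SER P̄(ρ) = (1/2)·E[exp(−ρX)] satisfies, for every t > 0, lim_{ρ→∞} P̄(tρ)/P̄(ρ) = t^(−D). -/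
open MeasureTheory Real Set Filter

theorem one_add_mul_div_one_add_eq {t x : ℝ} (hx : 0 < x) :
    (1 + t * x) / (1 + x) = t + (1 - t) * (1 + x)⁻¹ := by
  have : 1 + x ≠ 0 := by positivity
  field_simp
  ring

theorem abs_log_one_add_mul_sub_le {t x : ℝ} (ht : 0 < t) (hx : 0 < x) :
    |log (1 + t * x) - log (1 + x)| ≤ |log t| := by
  have htx : 0 < t * x := mul_pos ht hx
  have hprod : log t + log (1 + x) = log (t + t * x) := by
    rw [← log_mul ht.ne' (by positivity)]
    ring_nf
  rcases le_total 1 t with h | h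
  · have h₁ : log (1 + x) ≤ log (1 + t * x) := log_le_log (by positivity) (by nlinarith)
    have h₂ : log (1 + t * x) ≤ log (t + t * x) := log_le_log (by positivity) (by linarith)
    rw [abs_of_nonneg (by linarith), abs_of_nonneg (log_nonneg h)]
    linarith
  · have h₁ : log (1 + t * x) ≤ log (1 + x) := log_le_log (by positivity) (by nlinarith)
    have h₂ : log (t + t * x) ≤ log (1 + t * x) := log_le_log (by positivity) (by linarith)
    rw [abs_of_nonpos (by linarith), abs_of_nonpos (log_nonpos ht.le h)]
    linarith

theorem tendsto_log_one_add_mul_sub {t : ℝ} (ht : 0 < t) :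
    Tendsto (fun x : ℝ => log (1 + t * x) - log (1 + x)) atTop (nhds (log t)) := by
  have hinv : Tendsto (fun x : ℝ => t + (1 - t) * (1 + x)⁻¹) atTop (nhds t) := by
    simpa using ((tendsto_inv_atTop_zero.comp
      (tendsto_atTop_add_const_left atTop (1 : ℝ) tendsto_id)).const_mul (1 - t)).const_add t
  refine (hinv.log ht.ne').congr' ?_
  filter_upwards [eventually_gt_atTop 0] with x hx
  rw [← one_add_mul_div_one_add_eq hx, log_div (by positivity) (by positivity)]

/-- The increments of the Laplace exponent of a finite Thorin measure on a logarithmic scale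
converge to the Thorin mass times the length of the increment. -/
theorem tendsto_integral_log_one_add_div_sub {μ : Measure ℝ}
    (hfin : μ (Ioi (0 : ℝ)) ≠ ⊤) {t : ℝ} (ht : 0 < t) :
    Tendsto (fun ρ : ℝ => ∫ u in Ioi (0 : ℝ), (log (1 + t * ρ / u) - log (1 + ρ / u)) ∂μ)
      atTop (nhds ((μ (Ioi (0 : ℝ))).toReal * log t)) := by
  have hlim : (μ (Ioi (0 : ℝ))).toReal * log t = ∫ _ in Ioi (0 : ℝ), log t ∂μ := by
    simp [Measure.real]
  rw [hlim]
  refine tendsto_integral_filter_of_dominated_convergence (fun _ => |log t|) ?_ ?_ ?_ ?_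
  · exact Eventually.of_forall fun ρ =>
      Measurable.aestronglyMeasurable (by fun_prop)
  · filter_upwards [eventually_gt_atTop 0] with ρ hρ
    filter_upwards [ae_restrict_mem measurableSet_Ioi] with u hu
    rw [mul_div_assoc, norm_eq_abs]
    exact abs_log_one_add_mul_sub_le ht (div_pos hρ hu)
  · exact integrableOn_const hfin
  · filter_upwards [ae_restrict_mem measurableSet_Ioi] with u hu
    simpa only [mul_div_assoc] using! (tendsto_log_one_add_mul_sub ht).comp
      (tendsto_id.atTop_div_const hu)

/-- The diversity order of DPSK over a nondegenerate GGC fading channel with finite positive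
Thorin mass `D` equals `D`: the average SER `P̄(ρ) = (1/2) E[exp(-ρX)]` satisfies
`lim_{ρ→∞} P̄(tρ)/P̄(ρ) = t^(-D)` for every `t > 0`. -/
theorem ggc_dpsk_diversity_order {Ω : Type*} [MeasurableSpace Ω]
    (P : Measure Ω) [IsProbabilityMeasure P] (X : Ω → ℝ) (hX : Measurable X)
    (μ : Measure ℝ) (hGGC : IsGGC P X μ)
    (hfin : μ (Set.Ioi (0:ℝ)) ≠ ⊤)
    (D : ℝ) (hD : D = (μ (Set.Ioi (0:ℝ))).toReal) (hDpos : 0 < D) :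
    ∀ t : ℝ, 0 < t →
      Tendsto (fun ρ : ℝ =>
          ((1/2) * ∫ ω, Real.exp (-(t * ρ * X ω)) ∂P) /
            ((1/2) * ∫ ω, Real.exp (-(ρ * X ω)) ∂P))
        atTop (nhds (t ^ (-D))) := by
  intro t ht
  obtain ⟨-, hint, hlap⟩ := hGGC
  have hpow : t ^ (-D) = exp (-(D * log t)) := by
    rw [rpow_def_of_pos ht]
    ring_nf
  rw [hpow, hD]
  refine ((continuous_exp.tendsto _).comp
    (tendsto_integral_log_one_add_div_sub hfin ht).neg).congr' ?_
  filter_upwards [eventually_ge_atTop 0] with ρ hρ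
  have htρ : 0 ≤ t * ρ := mul_nonneg ht.le hρ
  rw [mul_div_mul_left _ _ (by norm_num), hlap _ htρ, hlap _ hρ, ← exp_sub,
    Function.comp_apply, integral_sub (hint _ htρ) (hint _ hρ)]
  ring_nf
end

section
/- Let m₁, m₂ > 0, let U₁ and U₂ be Gamma(m₁,1)- and Gamma(m₂,1)-distributed random variables, and let A and B be nonnegative random variables with A independent of U₁ and B independent of U₂. Set X = A·U₁ and Y = B·U₂. If m₁ ≤ m₂ and A ≤_Lt B, then X ≤_Lt Y. -/
open MeasureTheory ProbabilityTheory Real Set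

/-- The gamma distribution is concentrated on the nonnegative half-line. -/
lemma ae_nonneg_gammaMeasure (a r : ℝ) : ∀ᵐ x ∂gammaMeasure a r, 0 ≤ x := by
  have h : {x : ℝ | ¬ 0 ≤ x} = Iio 0 := by ext; simp
  rw [ae_iff, h, gammaMeasure, withDensity_apply _ measurableSet_Iio]
  exact lintegral_gammaPDF_of_nonpos le_rfl

/-- The Laplace transform of the gamma distribution with unit rate. -/
lemma integral_exp_neg_mul_gammaMeasure {a s : ℝ} (ha : 0 < a) (hs : 0 ≤ s) :
    ∫ x, Real.exp (-(s * x)) ∂gammaMeasure a 1 = (1 / (1 + s)) ^ a := by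
  have hmeas : Measurable (gammaPDF a 1) := (measurable_gammaPDFReal a 1).ennreal_ofReal
  rw [gammaMeasure, integral_withDensity_eq_integral_toReal_smul hmeas
    (ae_of_all _ fun x => ENNReal.ofReal_lt_top)]
  have hzero : ∀ x ∉ Ici (0 : ℝ), (gammaPDF a 1 x).toReal • Real.exp (-(s * x)) = 0 := by
    intro x hx
    rw [gammaPDF_of_neg (not_le.mp hx)]
    simp
  rw [← setIntegral_eq_integral_of_forall_compl_eq_zero hzero, integral_Ici_eq_integral_Ioi]
  have hpdf : ∀ x ∈ Ioi (0 : ℝ), (gammaPDF a 1 x).toReal • Real.exp (-(s * x)) =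
      (Real.Gamma a)⁻¹ * (x ^ (a - 1) * Real.exp (-((1 + s) * x))) := by
    intro x hx
    rw [gammaPDF, ENNReal.toReal_ofReal (gammaPDFReal_nonneg ha one_pos x), gammaPDFReal,
      if_pos (le_of_lt hx), smul_eq_mul, Real.one_rpow,
      show -((1 + s) * x) = -(1 * x) + -(s * x) by ring, Real.exp_add]
    ring
  rw [setIntegral_congr_fun measurableSet_Ioi hpdf, integral_const_mul,
    Real.integral_rpow_mul_exp_neg_mul_Ioi ha (by linarith)]
  field_simp [(Real.Gamma_pos_of_pos ha).ne']

lemma integrable_exp_neg_of_ae_nonneg {α : Type*} [MeasurableSpace α] {μ : Measure α}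
    [IsFiniteMeasure μ] {f : α → ℝ} (hf : Measurable f) (h : ∀ᵐ x ∂μ, 0 ≤ f x) :
    Integrable (fun x => Real.exp (-f x)) μ := by
  refine Integrable.of_bound hf.neg.exp.aestronglyMeasurable 1 ?_
  filter_upwards [h] with x hx
  rw [Real.norm_eq_abs, abs_of_pos (Real.exp_pos _)]
  exact Real.exp_le_one_iff.mpr (neg_nonpos.mpr hx)

lemma integrable_exp_neg_mul_prod {α : Type*} [MeasurableSpace α] {μ : Measure α}
    [IsFiniteMeasure μ] {ν : Measure ℝ} [IsFiniteMeasure ν] {X : α → ℝ} (hX : Measurable X)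
    (hXnn : ∀ ω, 0 ≤ X ω) (hν : ∀ᵐ u ∂ν, 0 ≤ u) {ρ : ℝ} (hρ : 0 ≤ ρ) :
    Integrable (fun z : α × ℝ => Real.exp (-(ρ * (X z.1 * z.2)))) (μ.prod ν) := by
  refine integrable_exp_neg_of_ae_nonneg (by fun_prop) ?_
  filter_upwards [Measure.quasiMeasurePreserving_snd.ae hν] with z hz
  exact mul_nonneg hρ (mul_nonneg (hXnn _) hz)

/-- For independent `X` and `U`, the expectation of `exp (-(ρ * (X * U)))` may be computed
over the product of the underlying space with the law of `U`. -/
lemma integral_exp_neg_mul_of_indepFun {Ω : Type*} [MeasurableSpace Ω] {P : Measure Ω}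
    [IsProbabilityMeasure P] {X U : Ω → ℝ} (hX : Measurable X) (hU : Measurable U)
    (h : IndepFun X U P) (ρ : ℝ) :
    ∫ ω, Real.exp (-(ρ * (X ω * U ω))) ∂P =
      ∫ z : Ω × ℝ, Real.exp (-(ρ * (X z.1 * z.2))) ∂(P.prod (P.map U)) := by
  have : IsProbabilityMeasure (P.map U) := Measure.isProbabilityMeasure_map hU.aemeasurable
  have hg : Measurable fun z : ℝ × ℝ => Real.exp (-(ρ * (z.1 * z.2))) := by fun_prop
  have hlaw := (indepFun_iff_map_prod_eq_prod_map_map hX.aemeasurable hU.aemeasurable).mp h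
  have hprod : (P.prod (P.map U)).map (Prod.map X id) = (P.map X).prod (P.map U) := by
    rw [← Measure.map_prod_map P (P.map U) hX measurable_id, Measure.map_id]
  calc ∫ ω, Real.exp (-(ρ * (X ω * U ω))) ∂P
      = ∫ z, Real.exp (-(ρ * (z.1 * z.2))) ∂(P.map fun ω => (X ω, U ω)) :=
        (integral_map (hX.prodMk hU).aemeasurable hg.aestronglyMeasurable).symm
    _ = ∫ z, Real.exp (-(ρ * (z.1 * z.2))) ∂((P.prod (P.map U)).map (Prod.map X id)) := by
        rw [hlaw, hprod]
    _ = ∫ z : Ω × ℝ, Real.exp (-(ρ * (X z.1 * z.2))) ∂(P.prod (P.map U)) :=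
        integral_map (hX.prodMap measurable_id).aemeasurable hg.aestronglyMeasurable

/-- Integrating out the gamma variable first. -/
lemma integral_prod_gammaMeasure_exp_neg_mul {α : Type*} [MeasurableSpace α] {μ : Measure α}
    [IsFiniteMeasure μ] {X : α → ℝ} (hX : Measurable X) (hXnn : ∀ ω, 0 ≤ X ω) {a : ℝ}
    (ha : 0 < a) {ρ : ℝ} (hρ : 0 ≤ ρ) :
    Integrable (fun ω => (1 / (1 + ρ * X ω)) ^ a) μ ∧
      ∫ z : α × ℝ, Real.exp (-(ρ * (X z.1 * z.2))) ∂(μ.prod (gammaMeasure a 1)) =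
        ∫ ω, (1 / (1 + ρ * X ω)) ^ a ∂μ := by
  have := isProbabilityMeasure_gammaMeasure ha one_pos
  have hint := integrable_exp_neg_mul_prod (μ := μ) hX hXnn (ae_nonneg_gammaMeasure a 1) hρ
  have heq : (fun ω => ∫ u, Real.exp (-(ρ * (X ω * u))) ∂gammaMeasure a 1) =
      fun ω => (1 / (1 + ρ * X ω)) ^ a := by
    funext ω
    simp_rw [← mul_assoc]
    exact integral_exp_neg_mul_gammaMeasure ha (mul_nonneg hρ (hXnn ω))
  refine ⟨heq ▸ hint.integral_prod_left, ?_⟩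
  rw [integral_prod _ hint]
  exact congrArg (fun f => ∫ ω, f ω ∂μ) heq

/-- Laplace transform ordering of gamma variance mixtures: if `X = A·U₁` and `Y = B·U₂` with
`U₁ ~ Gamma(m₁,1)`, `U₂ ~ Gamma(m₂,1)`, `A ⟂ U₁`, `B ⟂ U₂`, `m₁ ≤ m₂` and `A ≤_Lt B`,
then `X ≤_Lt Y`. -/
theorem gamma_mixture_lt_order {Ω : Type*} [MeasurableSpace Ω]
    (P : Measure Ω) [IsProbabilityMeasure P]
    (m₁ m₂ : ℝ) (hm₁ : 0 < m₁) (hm₂ : 0 < m₂) (hm : m₁ ≤ m₂)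
    (A B U₁ U₂ : Ω → ℝ)
    (hA : Measurable A) (hB : Measurable B)
    (hU₁ : Measurable U₁) (hU₂ : Measurable U₂)
    (hAnn : ∀ ω, 0 ≤ A ω) (hBnn : ∀ ω, 0 ≤ B ω)
    (hU₁law : Measure.map U₁ P = gammaMeasure m₁ 1)
    (hU₂law : Measure.map U₂ P = gammaMeasure m₂ 1)
    (hindep₁ : IndepFun A U₁ P) (hindep₂ : IndepFun B U₂ P)
    (hLt : ∀ ρ : ℝ, 0 ≤ ρ →
      ∫ ω, Real.exp (-(ρ * B ω)) ∂P ≤ ∫ ω, Real.exp (-(ρ * A ω)) ∂P) :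
    ∀ ρ : ℝ, 0 ≤ ρ →
      ∫ ω, Real.exp (-(ρ * (B ω * U₂ ω))) ∂P ≤
        ∫ ω, Real.exp (-(ρ * (A ω * U₁ ω))) ∂P := by
  intro ρ hρ
  have := isProbabilityMeasure_gammaMeasure hm₁ one_pos
  have := isProbabilityMeasure_gammaMeasure hm₂ one_pos
  rw [integral_exp_neg_mul_of_indepFun hA hU₁ hindep₁, hU₁law,
    integral_exp_neg_mul_of_indepFun hB hU₂ hindep₂, hU₂law]
  have hnn := ae_nonneg_gammaMeasure m₁ 1
  have hintA := integrable_exp_neg_mul_prod (μ := P) hA hAnn hnn hρ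
  have hintB := integrable_exp_neg_mul_prod (μ := P) hB hBnn hnn hρ
  obtain ⟨hi₁, h₁⟩ := integral_prod_gammaMeasure_exp_neg_mul (μ := P) hB hBnn hm₁ hρ
  obtain ⟨hi₂, h₂⟩ := integral_prod_gammaMeasure_exp_neg_mul (μ := P) hB hBnn hm₂ hρ
  calc ∫ z : Ω × ℝ, Real.exp (-(ρ * (B z.1 * z.2))) ∂(P.prod (gammaMeasure m₂ 1))
      ≤ ∫ z : Ω × ℝ, Real.exp (-(ρ * (B z.1 * z.2))) ∂(P.prod (gammaMeasure m₁ 1)) := by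
        rw [h₁, h₂]
        refine integral_mono hi₂ hi₁ fun ω => ?_
        have hpos : 0 ≤ ρ * B ω := mul_nonneg hρ (hBnn ω)
        exact Real.rpow_le_rpow_of_exponent_ge (by positivity)
          ((div_le_one (by linarith)).mpr (by linarith)) hm
    _ ≤ ∫ z : Ω × ℝ, Real.exp (-(ρ * (A z.1 * z.2))) ∂(P.prod (gammaMeasure m₁ 1)) := by
        rw [integral_prod_symm _ hintA, integral_prod_symm _ hintB]
        refine integral_mono_ae hintB.integral_prod_right hintA.integral_prod_right ?_
        filter_upwards [hnn] with u hu
        have key := hLt (ρ * u) (mul_nonneg hρ hu)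
        simpa only [mul_assoc, mul_comm u] using key
end

section
/- Let K ≥ 0. Then for all s ≥ 0, the Laplace exponent of the Rician-K instantaneous channel power admits the Lévy (Bernstein) representation Ks/(1+K+s) + log(1+s/(1+K)) = ∫₀^∞ (1 − exp(−su))·exp(−(1+K)u)·(K(1+K) + 1/u) du. Consequently the Laplace exponent is a Bernstein function with Lévy density τ(u) = exp(−(1+K)u)(K(1+K) + 1/u), so the Rician-K instantaneous channel power is infinitely divisible. -/
open MeasureTheory Real Set

theorem integrableOn_exp_neg_mul_Ioi_zero {a : ℝ} (ha : 0 < a) :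
    IntegrableOn (fun u : ℝ => Real.exp (-(a * u))) (Set.Ioi 0) := by
  simpa [neg_mul] using integrableOn_exp_mul_Ioi (neg_neg_of_pos ha) 0

theorem integral_exp_neg_mul_Ioi_zero {a : ℝ} (ha : 0 < a) :
    ∫ u in Set.Ioi (0 : ℝ), Real.exp (-(a * u)) = a⁻¹ := by
  simpa [neg_mul, neg_div_neg_eq] using integral_exp_mul_Ioi (neg_neg_of_pos ha) 0

theorem integrableOn_inv_mul_exp_sub_exp {a b : ℝ} (ha : 0 < a) (hab : a ≤ b) :
    IntegrableOn (fun u : ℝ => u⁻¹ * (Real.exp (-(a * u)) - Real.exp (-(b * u))))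
      (Set.Ioi 0) := by
  refine Integrable.mono' ((integrableOn_exp_neg_mul_Ioi_zero ha).const_mul (b - a))
    (by fun_prop) ?_
  filter_upwards [ae_restrict_mem measurableSet_Ioi] with u (hu : 0 < u)
  have hle : Real.exp (-(b * u)) ≤ Real.exp (-(a * u)) := by gcongr
  have hsplit : Real.exp (-(b * u)) = Real.exp (-(a * u)) * Real.exp (-((b - a) * u)) := by
    rw [← Real.exp_add]; ring_nf
  have hlin := Real.add_one_le_exp (-((b - a) * u))
  rw [Real.norm_of_nonneg (mul_nonneg (inv_nonneg.2 hu.le) (sub_nonneg.2 hle)),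
    inv_mul_le_iff₀ hu, hsplit]
  nlinarith [Real.exp_pos (-(a * u))]

/-- Frullani's integral for the exponential function. -/
theorem integral_inv_mul_exp_sub_exp {a b : ℝ} (ha : 0 < a) (hab : a ≤ b) :
    ∫ u in Set.Ioi (0 : ℝ), u⁻¹ * (Real.exp (-(a * u)) - Real.exp (-(b * u))) =
      Real.log (b / a) := by
  have hcont : Continuous fun x : ℝ => Real.exp (-x) := by fun_prop
  have h := Frullani.integral_Ioi_eq (f := fun x : ℝ => Real.exp (-x)) (L := 1) (R := 0)
    (hcont.locallyIntegrable.locallyIntegrableOn _) ha (ha.trans_le hab)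
    (by simpa using (hcont.tendsto 0).mono_left nhdsWithin_le_nhds)
    Real.tendsto_exp_neg_atTop_nhds_zero
    (by simpa only [smul_eq_mul] using integrableOn_inv_mul_exp_sub_exp ha hab)
  simpa using h

/-- Lévy (Bernstein) representation of the Laplace exponent of the Rician-`K` instantaneous
channel power: for all `K ≥ 0` and `s ≥ 0`,
`Ks/(1+K+s) + log (1+s/(1+K)) = ∫₀^∞ (1 - e^{-su}) e^{-(1+K)u} (K(1+K) + 1/u) du`,
so the Laplace exponent is a Bernstein function with Lévy density
`τ(u) = e^{-(1+K)u}(K(1+K) + 1/u)` and the Rician-`K` power is infinitely divisible. -/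
theorem rician_laplace_exponent_levy_representation (K : ℝ) (hK : 0 ≤ K) :
    ∀ s : ℝ, 0 ≤ s →
      K * s / (1 + K + s) + Real.log (1 + s / (1 + K)) =
        ∫ u in Set.Ioi (0:ℝ),
          (1 - Real.exp (-(s * u))) * (Real.exp (-((1 + K) * u)) * (K * (1 + K) + 1 / u)) := by
  intro s hs
  have ha : 0 < 1 + K := by linarith
  have hb : 0 < 1 + K + s := by linarith
  have hab : 1 + K ≤ 1 + K + s := by linarith
  have hdiff : IntegrableOn
      (fun u : ℝ => Real.exp (-((1 + K) * u)) - Real.exp (-((1 + K + s) * u))) (Set.Ioi 0) :=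
    (integrableOn_exp_neg_mul_Ioi_zero ha).sub (integrableOn_exp_neg_mul_Ioi_zero hb)
  have hsplit : ∀ u : ℝ,
      (1 - Real.exp (-(s * u))) * (Real.exp (-((1 + K) * u)) * (K * (1 + K) + 1 / u)) =
        K * (1 + K) * (Real.exp (-((1 + K) * u)) - Real.exp (-((1 + K + s) * u))) +
          u⁻¹ * (Real.exp (-((1 + K) * u)) - Real.exp (-((1 + K + s) * u))) := by
    intro u
    have hexp : Real.exp (-((1 + K + s) * u)) =
        Real.exp (-((1 + K) * u)) * Real.exp (-(s * u)) := by
      rw [← Real.exp_add]; ring_nf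
    rw [hexp]
    ring
  simp_rw [hsplit]
  rw [integral_add (hdiff.const_mul _) (integrableOn_inv_mul_exp_sub_exp ha hab),
    integral_const_mul,
    integral_sub (integrableOn_exp_neg_mul_Ioi_zero ha) (integrableOn_exp_neg_mul_Ioi_zero hb),
    integral_exp_neg_mul_Ioi_zero ha, integral_exp_neg_mul_Ioi_zero hb,
    integral_inv_mul_exp_sub_exp ha hab]
  congr 1
  · field_simp
    ring
  · rw [add_div, div_self ha.ne']
end

section
/- Let K > 1 and define g(u) = u·τ(u) = exp(−(1+K)u)·(K(1+K)u + 1) for u > 0, where τ is the Lévy density of the Laplace exponent of the Rician-K instantaneous channel power. Then g is not completely monotone: its derivative g′(u) = (1+K)·exp(−(1+K)u)·(K − 1 − K(1+K)u) is strictly positive for all 0 < u < (K−1)/(K(1+K)). Hence the Rician-K instantaneous channel power is not a generalized gamma convolution for K > 1. -/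
open Real Set

/-- A function `h` is completely monotone on a set `s ⊆ ℝ`: it is infinitely differentiable
there and `(-1)^k h^(k)(x) ≥ 0` for all `x ∈ s` and all `k ≥ 0`. -/
def CompletelyMonotoneOn (h : ℝ → ℝ) (s : Set ℝ) : Prop :=
  (∀ x ∈ s, ContDiffAt ℝ (⊤ : ℕ∞) h x) ∧
  (∀ k : ℕ, ∀ x ∈ s, 0 ≤ (-1 : ℝ) ^ k * iteratedDeriv k h x)

/-- For `K > 1` the function `g(u) = u τ(u) = e^{-(1+K)u}(K(1+K)u + 1)`, where `τ` is the
Lévy density of the Rician-`K` Laplace exponent, is not completely monotone: its derivative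
`g'(u) = (1+K) e^{-(1+K)u} (K - 1 - K(1+K)u)` is strictly positive on
`(0, (K-1)/(K(1+K)))`.  Hence the Rician-`K` power is not a GGC for `K > 1`. -/
theorem rician_levy_density_not_completely_monotone (K : ℝ) (hK : 1 < K)
    (g : ℝ → ℝ) (hg : ∀ u : ℝ, g u = Real.exp (-((1 + K) * u)) * (K * (1 + K) * u + 1)) :
    (∀ u : ℝ, 0 < u →
        deriv g u = (1 + K) * Real.exp (-((1 + K) * u)) * (K - 1 - K * (1 + K) * u)) ∧
    (∀ u : ℝ, 0 < u → u < (K - 1) / (K * (1 + K)) → 0 < deriv g u) ∧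
    ¬ CompletelyMonotoneOn g (Set.Ioi 0) := by
  have hd (u : ℝ) : HasDerivAt g
      ((1 + K) * Real.exp (-((1 + K) * u)) * (K - 1 - K * (1 + K) * u)) u := by
    rw [funext hg]
    have h := (((hasDerivAt_id u).const_mul (1 + K)).neg.exp).mul
      (((hasDerivAt_id u).const_mul (K * (1 + K))).add_const 1)
    refine h.congr_deriv ?_
    simp only [id, Pi.neg_apply]
    ring
  have hpos : ∀ u : ℝ, 0 < u → u < (K - 1) / (K * (1 + K)) → 0 < deriv g u := by
    intro u _ hlt
    rw [lt_div_iff₀ (by positivity)] at hlt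
    rw [(hd u).deriv]
    exact mul_pos (by positivity) (by linarith)
  refine ⟨fun u _ => (hd u).deriv, hpos, fun ⟨_, hsign⟩ => ?_⟩
  have hend : 0 < (K - 1) / (K * (1 + K)) := div_pos (by linarith) (by positivity)
  have hneg := hsign 1 _ (half_pos hend)
  rw [iteratedDeriv_one] at hneg
  linarith [hpos _ (half_pos hend) (half_lt_self hend)]
end

section
/- For every r with 0 < r < 1 and every s ≥ 0, s^r = (r·sin(rπ)/π)·∫₀^∞ log(1 + s/u)·u^(r−1) du. Consequently, the positive α-stable distribution with Laplace transform exp(−s^r) is a generalized gamma convolution whose Thorin measure has density (r·sin(rπ)/π)·u^(r−1) on (0,∞), and its Thorin mass (diversity order) is infinite. -/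
open MeasureTheory Real Set

theorem lintegral_rpow_mul_exp_neg_mul_Ioi {a b : ℝ} (ha : 0 < a) (hb : 0 < b) :
    ∫⁻ t in Ioi (0 : ℝ), ENNReal.ofReal (t ^ (a - 1) * exp (-(b * t))) =
      ENNReal.ofReal ((1 / b) ^ a * Gamma a) := by
  have h := integral_rpow_mul_exp_neg_mul_Ioi ha hb
  have hpos : 0 < (1 / b) ^ a * Gamma a :=
    mul_pos (rpow_pos_of_pos (by positivity) _) (Gamma_pos_of_pos ha)
  rw [← h, ofReal_integral_eq_lintegral_ofReal]
  · exact not_imp_comm.1 integral_undef (by rw [h]; exact hpos.ne')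
  · filter_upwards [ae_restrict_mem measurableSet_Ioi] with t ht
    exact mul_nonneg (rpow_nonneg (le_of_lt ht) _) (exp_pos _).le

/-- The Stieltjes transform of `u ^ (r - 1)`. -/
theorem lintegral_rpow_div_add_Ioi {r v : ℝ} (hr0 : 0 < r) (hr1 : r < 1) (hv : 0 < v) :
    ∫⁻ u in Ioi (0 : ℝ), ENNReal.ofReal (u ^ (r - 1) / (u + v)) =
      ENNReal.ofReal (π / sin (π * r) * v ^ (r - 1)) := by
  have hG : 0 < Gamma r := Gamma_pos_of_pos hr0
  calc
    _ = ∫⁻ u in Ioi (0 : ℝ), ∫⁻ t in Ioi (0 : ℝ),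
          ENNReal.ofReal (u ^ (r - 1) * exp (-((u + v) * t))) := by
      refine setLIntegral_congr_fun measurableSet_Ioi fun u (hu : 0 < u) => ?_
      have h := lintegral_rpow_mul_exp_neg_mul_Ioi one_pos (add_pos hu hv)
      simp only [sub_self, rpow_zero, one_mul, rpow_one, Gamma_one, mul_one] at h
      simp only [ENNReal.ofReal_mul (rpow_nonneg hu.le (r - 1)), div_eq_mul_one_div (u ^ (r - 1))]
      rw [lintegral_const_mul _ (by fun_prop), h]
    _ = ∫⁻ t in Ioi (0 : ℝ), ∫⁻ u in Ioi (0 : ℝ),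
          ENNReal.ofReal (u ^ (r - 1) * exp (-((u + v) * t))) :=
      lintegral_lintegral_swap (by unfold Function.uncurry; fun_prop)
    _ = ∫⁻ t in Ioi (0 : ℝ), ENNReal.ofReal (Gamma r) *
          ENNReal.ofReal (t ^ ((1 - r) - 1) * exp (-(v * t))) := by
      refine setLIntegral_congr_fun measurableSet_Ioi fun t (ht : 0 < t) => ?_
      have h : ∀ u : ℝ, ENNReal.ofReal (u ^ (r - 1) * exp (-((u + v) * t))) =
          ENNReal.ofReal (exp (-(v * t))) * ENNReal.ofReal (u ^ (r - 1) * exp (-(t * u))) := by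
        intro u
        rw [← ENNReal.ofReal_mul (exp_pos _).le, mul_left_comm, ← exp_add]
        ring_nf
      simp only [h]
      rw [lintegral_const_mul _ (by fun_prop), lintegral_rpow_mul_exp_neg_mul_Ioi hr0 ht,
        ← ENNReal.ofReal_mul (exp_pos _).le, ← ENNReal.ofReal_mul hG.le, one_div,
        inv_rpow ht.le, ← rpow_neg ht.le]
      ring_nf
    _ = _ := by
      rw [lintegral_const_mul _ (by fun_prop),
        lintegral_rpow_mul_exp_neg_mul_Ioi (sub_pos.2 hr1) hv, ← ENNReal.ofReal_mul hG.le,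
        ← Gamma_mul_Gamma_one_sub, one_div, inv_rpow hv.le, ← rpow_neg hv.le, neg_sub]
      ring_nf

theorem lintegral_inv_add_eq_log {s u : ℝ} (hs : 0 ≤ s) (hu : 0 < u) :
    ∫⁻ v in Ioc 0 s, ENNReal.ofReal (1 / (u + v)) = ENNReal.ofReal (log (1 + s / u)) := by
  have hcont : ContinuousOn (fun v : ℝ => 1 / (u + v)) (Icc 0 s) :=
    ContinuousOn.div (by fun_prop) (by fun_prop) fun v hv => (add_pos_of_pos_of_nonneg hu hv.1).ne'
  have hint : ∫ v in Ioc 0 s, 1 / (u + v) = log (1 + s / u) := by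
    rw [← intervalIntegral.integral_of_le hs,
      intervalIntegral.integral_comp_add_left (fun x : ℝ => 1 / x),
      integral_one_div_of_pos (by linarith) (by linarith)]
    congr 1
    field_simp
    ring
  rw [← hint, ofReal_integral_eq_lintegral_ofReal]
  · exact hcont.integrableOn_Icc.mono_set Ioc_subset_Icc_self
  · filter_upwards [ae_restrict_mem measurableSet_Ioc] with v hv
    exact div_nonneg zero_le_one (add_pos hu hv.1).le

theorem lintegral_log_one_add_div_mul_rpow_Ioi {r s : ℝ} (hr0 : 0 < r) (hr1 : r < 1)
    (hs : 0 ≤ s) :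
    ∫⁻ u in Ioi (0 : ℝ), ENNReal.ofReal (log (1 + s / u) * u ^ (r - 1)) =
      ENNReal.ofReal (π / sin (π * r) * (s ^ r / r)) := by
  have hc : 0 ≤ π / sin (π * r) :=
    div_nonneg pi_pos.le (sin_nonneg_of_nonneg_of_le_pi (by positivity)
      (by nlinarith [pi_pos]))
  calc
    _ = ∫⁻ u in Ioi (0 : ℝ), ∫⁻ v in Ioc 0 s, ENNReal.ofReal (u ^ (r - 1) / (u + v)) := by
      refine setLIntegral_congr_fun measurableSet_Ioi fun u (hu : 0 < u) => ?_
      simp only [div_eq_mul_one_div (u ^ (r - 1)), ENNReal.ofReal_mul (rpow_nonneg hu.le (r - 1))]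
      rw [lintegral_const_mul _ (by fun_prop), lintegral_inv_add_eq_log hs hu,
        ← ENNReal.ofReal_mul (rpow_nonneg hu.le _), mul_comm]
    _ = ∫⁻ v in Ioc 0 s, ∫⁻ u in Ioi (0 : ℝ), ENNReal.ofReal (u ^ (r - 1) / (u + v)) :=
      lintegral_lintegral_swap (by unfold Function.uncurry; fun_prop)
    _ = ∫⁻ v in Ioc 0 s, ENNReal.ofReal (π / sin (π * r)) * ENNReal.ofReal (v ^ (r - 1)) := by
      refine setLIntegral_congr_fun measurableSet_Ioc fun v hv => ?_
      simp only [lintegral_rpow_div_add_Ioi hr0 hr1 hv.1, ENNReal.ofReal_mul hc]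
    _ = _ := by
      have hint : ∫ v in Ioc 0 s, v ^ (r - 1) = s ^ r / r := by
        rw [← intervalIntegral.integral_of_le hs, integral_rpow (Or.inl (by linarith))]
        simp [zero_rpow hr0.ne']
      rw [lintegral_const_mul _ (by fun_prop), ENNReal.ofReal_mul hc, ← hint,
        ofReal_integral_eq_lintegral_ofReal]
      · exact (intervalIntegrable_iff_integrableOn_Ioc_of_le hs).1
          (intervalIntegral.intervalIntegrable_rpow' (by linarith))
      · filter_upwards [ae_restrict_mem measurableSet_Ioc] with v hv
        exact rpow_nonneg hv.1.le _

theorem lintegral_rpow_Ioi_eq_top (p : ℝ) :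
    ∫⁻ u in Ioi (0 : ℝ), ENNReal.ofReal (u ^ p) = ⊤ := by
  by_contra h
  refine not_integrableOn_Ioi_rpow p ⟨(by fun_prop), ?_⟩
  rw [hasFiniteIntegral_iff_ofReal]
  · exact lt_top_iff_ne_top.2 h
  · filter_upwards [ae_restrict_mem measurableSet_Ioi] with u hu
    exact rpow_nonneg (le_of_lt hu) _

/-- For `0 < r < 1` and `s ≥ 0`,
`s^r = (r sin(rπ)/π) ∫₀^∞ log (1 + s/u) u^(r-1) du`, so the positive `α`-stable law with
Laplace transform `exp (-s^r)` is a GGC whose Thorin measure has density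
`(r sin(rπ)/π) u^(r-1)` on `(0,∞)`; moreover its Thorin mass (diversity order) is infinite. -/
theorem positive_stable_thorin_representation (r : ℝ) (hr0 : 0 < r) (hr1 : r < 1) :
    (∀ s : ℝ, 0 ≤ s →
      s ^ r = (r * Real.sin (r * Real.pi) / Real.pi) *
        ∫ u in Set.Ioi (0:ℝ), Real.log (1 + s / u) * u ^ (r - 1)) ∧
    (∫⁻ u in Set.Ioi (0:ℝ),
        ENNReal.ofReal (r * Real.sin (r * Real.pi) / Real.pi * u ^ (r - 1)) = ⊤) := by
  have hsin : 0 < sin (r * π) :=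
    sin_pos_of_pos_of_lt_pi (by positivity) (by nlinarith [pi_pos])
  have hc : 0 < r * sin (r * π) / π := by positivity
  refine ⟨fun s hs => ?_, ?_⟩
  · rw [integral_eq_lintegral_of_nonneg_ae, lintegral_log_one_add_div_mul_rpow_Ioi hr0 hr1 hs,
      mul_comm π r, ENNReal.toReal_ofReal (by positivity)]
    · field_simp
    · filter_upwards [ae_restrict_mem measurableSet_Ioi] with u (hu : 0 < u)
      have : 0 ≤ s / u := by positivity
      exact mul_nonneg (log_nonneg (by linarith)) (rpow_nonneg hu.le _)
    · exact Measurable.aestronglyMeasurable (by fun_prop)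
  · simp only [ENNReal.ofReal_mul hc.le]
    rw [lintegral_const_mul _ (by fun_prop), lintegral_rpow_Ioi_eq_top]
    exact ENNReal.mul_top (ENNReal.ofReal_pos.2 hc).ne'
end

section
/- Let X be a generalized gamma convolution (GGC) with Thorin measure μ whose Thorin mass D = μ((0,∞)) satisfies 0 < D < ∞. Then the law of X has a density f with respect to Lebesgue measure on (0,∞) of the form f(x) = x^(D−1)·h(x), where h : (0,∞) → [0,∞) is completely monotone. -/
open MeasureTheory Real Set

/-- The affine interpolation between `s` (at `y = 0`) and `1` (at `y = 1`). -/
def affineKernel (s y : ℝ) : ℝ := s * (1 - y) + y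

lemma affineKernel_pos {s y : ℝ} (hs : 0 < s) (hy : y ∈ Icc (0 : ℝ) 1) :
    0 < affineKernel s y := by
  unfold affineKernel
  rcases hy.2.lt_or_eq with h | h
  · have := mul_pos hs (sub_pos.2 h); linarith [hy.1]
  · simp [h]

@[fun_prop]
lemma continuous_affineKernel (s : ℝ) : Continuous (affineKernel s) := by
  unfold affineKernel; fun_prop

lemma continuous_affineKernel_rpow {s : ℝ} (hs : 0 < s) (A : ℝ) :
    Continuous fun y : unitInterval => affineKernel s y ^ A :=
  Continuous.rpow_const (by fun_prop) fun y => Or.inl (affineKernel_pos hs y.2).ne'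

lemma continuous_log_affineKernel {s : ℝ} (hs : 0 < s) :
    Continuous fun y : unitInterval => Real.log (affineKernel s y) :=
  Continuous.log (by fun_prop) fun y => (affineKernel_pos hs y.2).ne'

open ProbabilityTheory in
/-- Feynman's parametrization of a product of two powers. -/
lemma lintegral_betaMeasure_rpow {a b α β : ℝ} (ha : 0 < a) (hb : 0 < b) (hα : 0 < α)
    (hβ : 0 < β) :
    ∫⁻ v, ENNReal.ofReal ((v * a + (1 - v) * b) ^ (-(α + β))) ∂(betaMeasure α β) =
      ENNReal.ofReal (a ^ (-α) * b ^ (-β)) := by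
  have hL : ∀ v ∈ Ioo (0 : ℝ) 1, 0 < v * a + (1 - v) * b := fun v hv =>
    add_pos (mul_pos hv.1 ha) (mul_pos (sub_pos.2 hv.2) hb)
  set f : ℝ → ℝ := fun v => v * a / (v * a + (1 - v) * b) with hf
  have hderiv : ∀ v ∈ Ioo (0 : ℝ) 1,
      HasDerivWithinAt f (a * b / (v * a + (1 - v) * b) ^ 2) (Ioo 0 1) v := by
    intro v hv
    have h1 : HasDerivAt (fun v : ℝ => v * a) a v := by
      simpa using (hasDerivAt_id v).mul_const a
    have h2 : HasDerivAt (fun v : ℝ => (1 - v) * b) (-b) v := by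
      simpa using ((hasDerivAt_id v).const_sub 1).mul_const b
    have := (h1.div (h1.add h2) (hL v hv).ne').hasDerivWithinAt (s := Ioo 0 1)
    convert! this using 1
    simp only [Pi.add_apply]
    ring
  have hinj : InjOn f (Ioo 0 1) := by
    intro v hv w hw h
    simp only [hf] at h
    rw [div_eq_div_iff (hL v hv).ne' (hL w hw).ne'] at h
    have : a * b * (v - w) = 0 := by linear_combination h
    have := (mul_eq_zero.1 this).resolve_left (mul_pos ha hb).ne'
    linarith
  have himg : f '' Ioo 0 1 = Ioo 0 1 := by
    ext w
    constructor
    · rintro ⟨v, hv, rfl⟩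
      refine ⟨div_pos (mul_pos hv.1 ha) (hL v hv), ?_⟩
      rw [div_lt_one (hL v hv)]
      linarith [mul_pos (sub_pos.2 hv.2) hb]
    · intro hw
      have hd : 0 < w * b + (1 - w) * a :=
        add_pos (mul_pos hw.1 hb) (mul_pos (sub_pos.2 hw.2) ha)
      have hv : w * b / (w * b + (1 - w) * a) ∈ Ioo (0 : ℝ) 1 := by
        refine ⟨div_pos (mul_pos hw.1 hb) hd, ?_⟩
        rw [div_lt_one hd]
        linarith [mul_pos (sub_pos.2 hw.2) ha]
      refine ⟨_, hv, ?_⟩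
      have := hL _ hv
      simp only [hf]
      rw [div_eq_iff this.ne']
      field_simp
      ring
  have key := lintegral_image_eq_lintegral_abs_deriv_mul measurableSet_Ioo hderiv hinj
    (fun w => betaPDF α β w)
  have hone : ∫⁻ v in Ioo (0 : ℝ) 1, betaPDF α β v = 1 := by
    rw [← lintegral_betaPDF_eq_one hα hβ, lintegral_betaPDF]
    exact setLIntegral_congr_fun measurableSet_Ioo fun v hv => betaPDF_of_pos_lt_one hv.1 hv.2
  rw [himg, hone] at key
  have hpt : ∀ v ∈ Ioo (0 : ℝ) 1,
      ENNReal.ofReal |a * b / (v * a + (1 - v) * b) ^ 2| * betaPDF α β (f v) =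
        ENNReal.ofReal (a ^ α * b ^ β) * (betaPDF α β v *
          ENNReal.ofReal ((v * a + (1 - v) * b) ^ (-(α + β)))) := by
    intro v hv
    have hfv : f v ∈ Ioo (0 : ℝ) 1 := himg ▸ mem_image_of_mem f hv
    have hLv := hL v hv
    have hbeta := beta_pos hα hβ
    rw [betaPDF_of_pos_lt_one hfv.1 hfv.2, betaPDF_of_pos_lt_one hv.1 hv.2,
      ← ENNReal.ofReal_mul (abs_nonneg _), ← ENNReal.ofReal_mul (by
        have := hv.1; have := sub_pos.2 hv.2; positivity), ← ENNReal.ofReal_mul (by positivity)]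
    congr 1
    have h1f : 1 - f v = (1 - v) * b / (v * a + (1 - v) * b) := by
      simp only [hf]; field_simp; ring
    have hv1 := sub_pos.2 hv.2
    have hv0 := hv.1
    rw [h1f, abs_of_pos (by positivity)]
    simp only [hf]
    rw [Real.div_rpow (by positivity) hLv.le, Real.div_rpow (by positivity) hLv.le,
      Real.mul_rpow hv0.le ha.le, Real.mul_rpow hv1.le hb.le, Real.rpow_neg hLv.le,
      Real.rpow_add hLv, Real.rpow_sub_one hLv.ne', Real.rpow_sub_one hLv.ne',
      Real.rpow_sub_one ha.ne', Real.rpow_sub_one hb.ne']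
    field_simp
  rw [setLIntegral_congr_fun measurableSet_Ioo hpt, lintegral_const_mul _ (by
    unfold betaPDF; fun_prop)] at key
  have hrestr : ∫⁻ v, ENNReal.ofReal ((v * a + (1 - v) * b) ^ (-(α + β))) ∂(betaMeasure α β) =
      ∫⁻ v in Ioo (0 : ℝ) 1, betaPDF α β v *
          ENNReal.ofReal ((v * a + (1 - v) * b) ^ (-(α + β))) := by
    rw [betaMeasure, lintegral_withDensity_eq_lintegral_mul _
      (by unfold betaPDF; fun_prop) (by fun_prop)]
    refine (setLIntegral_eq_of_support_subset fun v hv => ?_).symm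
    by_contra h
    refine hv ?_
    simp only [mem_Ioo, not_and_or, not_lt] at h
    rcases h with h | h
    · simp [betaPDF_eq_zero_of_nonpos h]
    · simp [betaPDF_eq_zero_of_one_le h]
  rw [hrestr, Real.rpow_neg ha.le, Real.rpow_neg hb.le, ← mul_inv,
    ENNReal.ofReal_inv_of_pos (by positivity)]
  exact ENNReal.eq_inv_of_mul_eq_one_left (by rw [mul_comm]; exact key.symm)

open ProbabilityTheory in
lemma exists_probabilityMeasure_mul_affineKernel (ν : ProbabilityMeasure unitInterval)
    (y₀ : unitInterval) {α A : ℝ} (hα : 0 ≤ α) (hA : 0 ≤ A) :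
    ∃ ν' : ProbabilityMeasure unitInterval, ∀ s : ℝ, 0 < s →
      ∫⁻ y, ENNReal.ofReal (affineKernel s y ^ (-(α + A))) ∂(ν' : Measure unitInterval) =
        ENNReal.ofReal (affineKernel s y₀ ^ (-α)) *
          ∫⁻ y, ENNReal.ofReal (affineKernel s y ^ (-A)) ∂(ν : Measure unitInterval) := by
  rcases hα.eq_or_lt with rfl | hα
  · exact ⟨ν, fun s hs => by simp⟩
  rcases hA.eq_or_lt with rfl | hA
  · exact ⟨⟨Measure.dirac y₀, inferInstance⟩, fun s hs => by simp⟩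
  have := isProbabilityMeasureBeta hα hA
  set g : unitInterval × ℝ → unitInterval := fun p =>
    projIcc 0 1 zero_le_one (p.2 * y₀ + (1 - p.2) * p.1) with hg
  have hgm : Measurable g := by
    have : Continuous g := continuous_projIcc.comp (by fun_prop)
    exact this.measurable
  have hprob : IsProbabilityMeasure
      (((ν : Measure unitInterval).prod (betaMeasure α A)).map g) :=
    Measure.isProbabilityMeasure_map hgm.aemeasurable
  refine ⟨⟨_, hprob⟩, fun s hs => ?_⟩
  have hm : Measurable fun y : unitInterval => ENNReal.ofReal (affineKernel s y ^ (-(α + A))) :=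
    (continuous_affineKernel_rpow hs _).measurable.ennreal_ofReal
  have hsupp : ∀ᵐ v ∂(betaMeasure α A), v ∈ Ioo (0 : ℝ) 1 := by
    rw [betaMeasure, ae_withDensity_iff (by unfold betaPDF; fun_prop)]
    refine ae_of_all _ fun v hv => ?_
    by_contra h
    refine hv ?_
    simp only [mem_Ioo, not_and_or, not_lt] at h
    rcases h with h | h
    · exact betaPDF_eq_zero_of_nonpos h
    · exact betaPDF_eq_zero_of_one_le h
  simp only [ProbabilityMeasure.coe_mk]
  rw [lintegral_map hm hgm, lintegral_prod (fun p => ENNReal.ofReal (affineKernel s (g p) ^ (-(α + A))))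
      (hm.comp hgm).aemeasurable,
    ← lintegral_const_mul _ (continuous_affineKernel_rpow hs _).measurable.ennreal_ofReal]
  refine lintegral_congr fun y => ?_
  rw [← ENNReal.ofReal_mul (Real.rpow_nonneg (affineKernel_pos hs y₀.2).le _),
    ← lintegral_betaMeasure_rpow (affineKernel_pos hs y₀.2) (affineKernel_pos hs y.2) hα hA]
  refine lintegral_congr_ae ?_
  filter_upwards [hsupp] with v hv
  have hmem : v * (y₀ : ℝ) + (1 - v) * y ∈ Icc (0 : ℝ) 1 := by
    have := convex_Icc (0 : ℝ) 1 y₀.2 y.2 hv.1.le (sub_pos.2 hv.2).le (by ring)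
    simpa using this
  simp only [hg, projIcc_of_mem zero_le_one hmem]
  congr 2
  unfold affineKernel
  ring

lemma exists_probabilityMeasure_prod_affineKernel {ι : Type*} (F : Finset ι)
    (y : ι → unitInterval) (α : ι → ℝ) (hα : ∀ i, 0 ≤ α i) :
    ∃ ν : ProbabilityMeasure unitInterval, ∀ s : ℝ, 0 < s →
      ∫⁻ z, ENNReal.ofReal (affineKernel s z ^ (-∑ i ∈ F, α i)) ∂(ν : Measure unitInterval) =
        ∏ i ∈ F, ENNReal.ofReal (affineKernel s (y i) ^ (-α i)) := by
  classical
  induction F using Finset.induction_on with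
  | empty => exact ⟨⟨Measure.dirac 0, inferInstance⟩, fun s hs => by simp⟩
  | insert i F hi ih =>
    obtain ⟨ν, hν⟩ := ih
    obtain ⟨ν', hν'⟩ := exists_probabilityMeasure_mul_affineKernel ν (y i) (hα i)
      (Finset.sum_nonneg fun j (_ : j ∈ F) => hα j)
    refine ⟨ν', fun s hs => ?_⟩
    rw [Finset.sum_insert hi, Finset.prod_insert hi, hν' s hs, hν s hs]

/-- The Markov–Krein transform, for a measure that is the image of a finite measure under a
simple function. -/
lemma exists_markovKrein_simpleFunc (m : Measure unitInterval) [IsFiniteMeasure m]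
    (g : SimpleFunc unitInterval unitInterval) :
    ∃ ν : ProbabilityMeasure unitInterval, ∀ s : ℝ, 0 < s →
      ∫ z, affineKernel s z ^ (-m.real univ) ∂(ν : Measure unitInterval) =
        Real.exp (-∫ y, Real.log (affineKernel s (g y)) ∂m) := by
  have hint : ∀ φ : unitInterval → ℝ,
      ∫ y, φ (g y) ∂m = ∑ z ∈ g.range, m.real (g ⁻¹' {z}) * φ z := by
    intro φ
    have hφ : ∀ y, φ (g y) = ∑ z ∈ g.range, (g ⁻¹' {z}).indicator (fun _ => φ z) y := by
      intro y
      rw [Finset.sum_eq_single (g y) (fun z _ hz => indicator_of_notMem (fun h => hz h.symm) _)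
        (fun h => (h (g.mem_range_self y)).elim), indicator_of_mem (by simp)]
    simp_rw [hφ]
    rw [integral_finsetSum _ fun z _ =>
      (integrable_const (φ z)).indicator (g.measurableSet_preimage {z})]
    refine Finset.sum_congr rfl fun z _ => ?_
    rw [integral_indicator_const _ (g.measurableSet_preimage {z}), smul_eq_mul]
  obtain ⟨ν, hν⟩ := exists_probabilityMeasure_prod_affineKernel g.range id
    (fun z => m.real (g ⁻¹' {z})) fun z => measureReal_nonneg
  refine ⟨ν, fun s hs => ?_⟩
  have hmass : m.real univ = ∑ z ∈ g.range, m.real (g ⁻¹' {z}) := by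
    simpa using hint fun _ => 1
  rw [hint fun z => Real.log (affineKernel s z), hmass, integral_eq_lintegral_of_nonneg_ae
    (ae_of_all _ fun z => Real.rpow_nonneg (affineKernel_pos hs z.2).le _)
    (continuous_affineKernel_rpow hs _).aestronglyMeasurable, hν s hs,
    ← ENNReal.ofReal_prod_of_nonneg fun z _ => Real.rpow_nonneg (affineKernel_pos hs z.2).le _,
    ENNReal.toReal_ofReal (Finset.prod_nonneg fun z _ =>
      Real.rpow_nonneg (affineKernel_pos hs z.2).le _), ← Finset.sum_neg_distrib, Real.exp_sum]
  refine Finset.prod_congr rfl fun z _ => ?_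
  rw [id, Real.rpow_def_of_pos (affineKernel_pos hs z.2)]
  congr 1
  ring

open Filter Topology BoundedContinuousFunction in
/-- The Markov–Krein transform of a finite measure on the unit interval: its exponentiated
logarithmic potential is a generalized Stieltjes transform. -/
lemma exists_markovKrein (m : Measure unitInterval) [IsFiniteMeasure m] :
    ∃ ν : ProbabilityMeasure unitInterval, ∀ s : ℝ, 0 < s →
      ∫ z, affineKernel s z ^ (-m.real univ) ∂(ν : Measure unitInterval) =
        Real.exp (-∫ y, Real.log (affineKernel s y) ∂m) := by
  have hsm : StronglyMeasurable (id : unitInterval → unitInterval) := stronglyMeasurable_id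
  choose ν hν using fun n => exists_markovKrein_simpleFunc m (hsm.approx n)
  let U : Ultrafilter ℕ := Ultrafilter.of atTop
  have hU : (U : Filter ℕ) ≤ atTop := Ultrafilter.of_le atTop
  have hlim : Tendsto ν U (𝓝 (U.map ν).lim) := (U.map ν).le_nhds_lim
  refine ⟨(U.map ν).lim, fun s hs => ?_⟩
  have h1 := ProbabilityMeasure.tendsto_iff_forall_integral_tendsto.1 hlim
    (BoundedContinuousFunction.mkOfCompact ⟨_, continuous_affineKernel_rpow hs (-m.real univ)⟩)
  obtain ⟨K, hK⟩ := isCompact_univ.exists_bound_of_continuousOn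
    (continuous_log_affineKernel hs).continuousOn
  have h2 : Tendsto (fun n => ∫ y, Real.log (affineKernel s (hsm.approx n y)) ∂m) atTop
      (𝓝 (∫ y, Real.log (affineKernel s y) ∂m)) := by
    refine tendsto_integral_of_dominated_convergence (fun _ => K) (fun n => ?_)
      (integrable_const _) (fun n => ae_of_all _ fun y => hK _ (mem_univ _))
      (ae_of_all _ fun y => ?_)
    · exact ((continuous_log_affineKernel hs).measurable.comp
        (hsm.approx n).measurable).aestronglyMeasurable
    · exact ((continuous_log_affineKernel hs).tendsto _).comp (hsm.tendsto_approx y)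
  have h3 := ((Real.continuous_exp.tendsto _).comp h2.neg).mono_left hU
  refine tendsto_nhds_unique h1 (h3.congr fun n => ?_)
  simpa using (hν n s hs).symm

open NNReal BoundedContinuousFunction in
lemma measure_nnreal_ext_of_integral_exp {P Q : Measure ℝ≥0} [IsFiniteMeasure P]
    [IsFiniteMeasure Q]
    (h : ∀ n : ℕ, ∫ x : ℝ≥0, Real.exp (-x) ^ n ∂P = ∫ x : ℝ≥0, Real.exp (-x) ^ n ∂Q) :
    P = Q := by
  let A : StarSubalgebra ℝ (ℝ≥0 →ᵇ ℝ) :=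
    { carrier := {f | ∃ p : Polynomial ℝ, ∀ x : ℝ≥0, f x = p.eval (Real.exp (-x))}
      mul_mem' := by
        rintro f g ⟨p, hp⟩ ⟨q, hq⟩
        exact ⟨p * q, fun x => by simp [hp, hq]⟩
      add_mem' := by
        rintro f g ⟨p, hp⟩ ⟨q, hq⟩
        exact ⟨p + q, fun x => by simp [hp, hq]⟩
      algebraMap_mem' := fun r => ⟨Polynomial.C r, fun x => by
        simp [BoundedContinuousFunction.algebraMap_apply]⟩
      star_mem' := by
        rintro f ⟨p, hp⟩
        exact ⟨p, fun x => by simp [hp]⟩ }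
  have hcont : Continuous fun x : ℝ≥0 => Real.exp (-x) := by fun_prop
  have hbound : ∀ (n : ℕ) (x : ℝ≥0), ‖Real.exp (-x) ^ n‖ ≤ 1 := fun n x => by
    rw [Real.norm_of_nonneg (by positivity)]
    exact pow_le_one₀ (Real.exp_nonneg _) (Real.exp_le_one_iff.2 (by simp))
  refine ext_of_forall_mem_subalgebra_integral_eq_of_polish (A := A) ?_ ?_
  · intro x y hxy
    refine ⟨fun x : ℝ≥0 => Real.exp (-x), ⟨_, ⟨⟨⟨fun x : ℝ≥0 => Real.exp (-x), hcont⟩, ⟨2, ?_⟩⟩,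
      ?_, rfl⟩, rfl⟩, fun h => hxy (NNReal.coe_injective (by simpa using h))⟩
    · intro x y
      have hx := hbound 1 x
      have hy := hbound 1 y
      simp only [pow_one] at hx hy
      exact (dist_le_norm_add_norm _ _).trans (by simpa [one_add_one_eq_two] using add_le_add hx hy)
    · exact ⟨Polynomial.X, fun x => by simp⟩
  · rintro f ⟨p, hp⟩
    have hint : ∀ (ρ : Measure ℝ≥0) [IsFiniteMeasure ρ], ∫ x, f x ∂ρ =
        ∑ i ∈ Finset.range (p.natDegree + 1), p.coeff i * ∫ x : ℝ≥0, Real.exp (-x) ^ i ∂ρ := by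
      intro ρ _
      simp_rw [hp, Polynomial.eval_eq_sum_range]
      rw [integral_finsetSum]
      · simp_rw [integral_const_mul]
      · intro i _
        exact (Integrable.of_bound (hcont.pow i).aestronglyMeasurable 1
          (ae_of_all _ (hbound i))).const_mul _
    rw [hint P, hint Q]
    simp_rw [h]

/-- Two finite measures on the half-line whose Laplace transforms agree at the naturals agree. -/
lemma measure_ext_of_lintegral_exp_nat {a b : Measure ℝ} [IsFiniteMeasure a] [IsFiniteMeasure b]
    (ha : ∀ᵐ x ∂a, 0 ≤ x) (hb : ∀ᵐ x ∂b, 0 ≤ x)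
    (h : ∀ n : ℕ, ∫⁻ x, ENNReal.ofReal (Real.exp (-(n * x))) ∂a =
      ∫⁻ x, ENNReal.ofReal (Real.exp (-(n * x))) ∂b) : a = b := by
  have hm : Measurable Real.toNNReal := by fun_prop
  have hback : ∀ c : Measure ℝ, (∀ᵐ x ∂c, 0 ≤ x) →
      (c.map Real.toNNReal).map NNReal.toReal = c := by
    intro c hc
    rw [Measure.map_map (by fun_prop) hm]
    conv_rhs => rw [← Measure.map_id (μ := c)]
    refine Measure.map_congr ?_
    filter_upwards [hc] with x hx using Real.coe_toNNReal x hx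
  have hint : ∀ (c : Measure ℝ), (∀ᵐ x ∂c, 0 ≤ x) → ∀ n : ℕ,
      ∫ x : NNReal, Real.exp (-x) ^ n ∂(c.map Real.toNNReal) =
        (∫⁻ x, ENNReal.ofReal (Real.exp (-(n * x))) ∂c).toReal := by
    intro c hc n
    have hcont : Continuous fun x : NNReal => Real.exp (-x) ^ n := by fun_prop
    rw [integral_map hm.aemeasurable hcont.aestronglyMeasurable,
      integral_eq_lintegral_of_nonneg_ae
        (ae_of_all _ fun x => pow_nonneg (Real.exp_nonneg _) n) (by fun_prop)]
    congr 1
    refine lintegral_congr_ae ?_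
    filter_upwards [hc] with x hx
    rw [Real.coe_toNNReal x hx, ← Real.exp_nat_mul, mul_neg]
  rw [← hback a ha, ← hback b hb]
  congr 1
  exact measure_nnreal_ext_of_integral_exp fun n => by rw [hint a ha, hint b hb, h]

/-- Uniqueness of Laplace transforms of measures on the half-line which need not be finite. -/
lemma measure_ext_of_lintegral_exp {a b : Measure ℝ}
    (ha : ∀ᵐ x ∂a, 0 ≤ x) (hb : ∀ᵐ x ∂b, 0 ≤ x)
    (hfin : ∀ s : ℝ, 0 < s → ∫⁻ x, ENNReal.ofReal (Real.exp (-(s * x))) ∂a ≠ ⊤)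
    (h : ∀ s : ℝ, 0 < s → ∫⁻ x, ENNReal.ofReal (Real.exp (-(s * x))) ∂a =
      ∫⁻ x, ENNReal.ofReal (Real.exp (-(s * x))) ∂b) : a = b := by
  set w : ℝ → ENNReal := fun x => ENNReal.ofReal (Real.exp (-(1 * x))) with hw
  have hwm : Measurable w := by fun_prop
  have htilt : ∀ c : Measure ℝ, (c.withDensity w).withDensity (fun x => (w x)⁻¹) = c := fun c =>
    withDensity_inv_same hwm (ae_of_all _ fun x => by simp [hw, Real.exp_pos])
      (ae_of_all _ fun x => by simp [hw])
  have hlap : ∀ (c : Measure ℝ) (n : ℕ),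
      ∫⁻ x, ENNReal.ofReal (Real.exp (-(n * x))) ∂(c.withDensity w) =
        ∫⁻ x, ENNReal.ofReal (Real.exp (-((n + 1 : ℝ) * x))) ∂c := by
    intro c n
    rw [lintegral_withDensity_eq_lintegral_mul _ hwm (by fun_prop)]
    refine lintegral_congr fun x => ?_
    simp only [Pi.mul_apply, hw]
    rw [← ENNReal.ofReal_mul (Real.exp_nonneg _), ← Real.exp_add]
    congr 2
    ring
  have hac : ∀ c : Measure ℝ, (∀ᵐ x ∂c, 0 ≤ x) → ∀ᵐ x ∂(c.withDensity w), 0 ≤ x :=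
    fun c hc => (withDensity_absolutelyContinuous c w).ae_le hc
  have : IsFiniteMeasure (a.withDensity w) := isFiniteMeasure_withDensity (hfin 1 one_pos)
  have : IsFiniteMeasure (b.withDensity w) :=
    isFiniteMeasure_withDensity (h 1 one_pos ▸ hfin 1 one_pos)
  rw [← htilt a, ← htilt b, measure_ext_of_lintegral_exp_nat (hac a ha) (hac b hb) fun n => by
    rw [hlap, hlap, h _ (by positivity)]]

lemma lintegral_rpow_mul_exp_neg {D r : ℝ} (hD : 0 < D) (hr : 0 < r) :
    ∫⁻ x in Ioi (0 : ℝ), ENNReal.ofReal (x ^ (D - 1) * Real.exp (-(r * x))) =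
      ENNReal.ofReal (Real.Gamma D * r ^ (-D)) := by
  have hval := Real.integral_rpow_mul_exp_neg_mul_Ioi hD hr
  have hpos : 0 < (1 / r) ^ D * Real.Gamma D := by
    have := Real.Gamma_pos_of_pos hD
    positivity
  have hint : IntegrableOn (fun x => x ^ (D - 1) * Real.exp (-(r * x))) (Ioi 0) :=
    Integrable.of_integral_ne_zero (hval ▸ hpos.ne')
  rw [← ofReal_integral_eq_lintegral_ofReal hint
    (ae_restrict_of_forall_mem measurableSet_Ioi fun x hx =>
      mul_nonneg (Real.rpow_nonneg (le_of_lt hx) _) (Real.exp_nonneg _)), hval, one_div,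
    Real.inv_rpow hr.le, Real.rpow_neg hr.le, mul_comm]

/-- The mixing measure `c (1 - y) ^ (-D) ν(dy)`. -/
noncomputable def stieltjesTilt (c D : ℝ) (ν : Measure unitInterval) : Measure unitInterval :=
  ν.withDensity fun y => ENNReal.ofReal (c * (1 - (y : ℝ)) ^ (-D))

/-- The function `x ↦ c ∫ (1 - y) ^ (-D) exp (-x y / (1 - y)) ν(dy)`. -/
noncomputable def stieltjesFactor (c D : ℝ) (ν : Measure unitInterval) : ℝ → ℝ :=
  ProbabilityTheory.mgf (fun y : unitInterval => -((y : ℝ) / (1 - y))) (stieltjesTilt c D ν)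

lemma integrable_exp_stieltjesTilt {c D : ℝ} (hc : 0 ≤ c) (hD : 0 < D)
    (ν : Measure unitInterval) [IsFiniteMeasure ν] {x : ℝ} (hx : 0 < x) :
    Integrable (fun y : unitInterval => Real.exp (x * -((y : ℝ) / (1 - y))))
      (stieltjesTilt c D ν) := by
  rw [stieltjesTilt, integrable_withDensity_iff (by fun_prop) (ae_of_all _ fun y => by simp)]
  refine Integrable.of_bound (Measurable.aestronglyMeasurable (by fun_prop))
    (c * (1 + D / x) ^ D) (ae_of_all _ fun y => ?_)
  have hy1 : 0 ≤ 1 - (y : ℝ) := sub_nonneg.2 y.2.2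
  rw [ENNReal.toReal_ofReal (by positivity), Real.norm_of_nonneg (by positivity)]
  rcases hy1.eq_or_lt with h | h
  · rw [← h, Real.zero_rpow (by linarith)]
    simp only [mul_zero]
    positivity
  · set t := (y : ℝ) / (1 - y) with ht
    have ht0 : 0 ≤ t := div_nonneg y.2.1 hy1
    have h1t : 1 + t = (1 - (y : ℝ))⁻¹ := by rw [ht]; field_simp; ring
    have hle : 1 + t ≤ (1 + D / x) * Real.exp (x * t / D) := by
      refine le_trans ?_ (mul_le_mul_of_nonneg_left (Real.add_one_le_exp _) (by positivity))
      have : (1 + D / x) * (x * t / D + 1) = 1 + t + (x * t / D + D / x) := by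
        field_simp; ring
      rw [this]
      have : 0 ≤ x * t / D + D / x := by positivity
      linarith
    have hpow : (1 - (y : ℝ)) ^ (-D) ≤ (1 + D / x) ^ D * Real.exp (x * t) := by
      rw [Real.rpow_neg hy1, ← Real.inv_rpow hy1, ← h1t]
      refine (Real.rpow_le_rpow (by positivity) hle hD.le).trans ?_
      rw [Real.mul_rpow (by positivity) (Real.exp_nonneg _), ← Real.exp_mul,
        div_mul_cancel₀ _ hD.ne']
    calc Real.exp (x * -t) * (c * (1 - (y : ℝ)) ^ (-D))
        ≤ Real.exp (x * -t) * (c * ((1 + D / x) ^ D * Real.exp (x * t))) := by gcongr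
      _ = c * (1 + D / x) ^ D * (Real.exp (x * -t) * Real.exp (x * t)) := by ring
      _ = c * (1 + D / x) ^ D := by rw [← Real.exp_add]; simp

lemma mem_interior_integrableExpSet_stieltjesTilt {c D : ℝ} (hc : 0 ≤ c) (hD : 0 < D)
    (ν : Measure unitInterval) [IsFiniteMeasure ν] {x : ℝ} (hx : 0 < x) :
    x ∈ interior (ProbabilityTheory.integrableExpSet
      (fun y : unitInterval => -((y : ℝ) / (1 - y))) (stieltjesTilt c D ν)) :=
  mem_interior.2 ⟨Ioi 0, fun _ hz => integrable_exp_stieltjesTilt hc hD ν hz, isOpen_Ioi, hx⟩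

lemma completelyMonotoneOn_stieltjesFactor {c D : ℝ} (hc : 0 ≤ c) (hD : 0 < D)
    (ν : Measure unitInterval) [IsFiniteMeasure ν] :
    CompletelyMonotoneOn (stieltjesFactor c D ν) (Ioi 0) := by
  refine ⟨fun x hx => (ProbabilityTheory.analyticAt_mgf
    (mem_interior_integrableExpSet_stieltjesTilt hc hD ν hx)).contDiffAt, fun k x hx => ?_⟩
  rw [stieltjesFactor, ProbabilityTheory.iteratedDeriv_mgf
    (mem_interior_integrableExpSet_stieltjesTilt hc hD ν hx), ← integral_const_mul]
  refine integral_nonneg fun y => ?_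
  have hy : 0 ≤ (y : ℝ) / (1 - y) := div_nonneg y.2.1 (sub_nonneg.2 y.2.2)
  change 0 ≤ (-1 : ℝ) ^ k * ((-((y : ℝ) / (1 - y))) ^ k * Real.exp (x * -((y : ℝ) / (1 - y))))
  rw [← mul_assoc, ← mul_pow, neg_one_mul, neg_neg]
  positivity

lemma aemeasurable_rpow_mul_stieltjesFactor {c D : ℝ} (hc : 0 ≤ c) (hD : 0 < D)
    (ν : Measure unitInterval) [IsFiniteMeasure ν] :
    AEMeasurable (fun x => ENNReal.ofReal (x ^ (D - 1) * stieltjesFactor c D ν x))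
      (volume.restrict (Ioi 0)) := by
  have : ContinuousOn (stieltjesFactor c D ν) (Ioi 0) := fun x hx =>
    ((completelyMonotoneOn_stieltjesFactor hc hD ν).1 x hx).continuousAt.continuousWithinAt
  have := this.aemeasurable (μ := volume) measurableSet_Ioi
  fun_prop

lemma lintegral_exp_neg_mul_stieltjesFactor {c D s : ℝ} (hc : 0 ≤ c) (hD : 0 < D)
    (ν : Measure unitInterval) [IsFiniteMeasure ν] (hν : ν {1} = 0) (hs : 0 < s) :
    ∫⁻ x, ENNReal.ofReal (Real.exp (-(s * x))) ∂((volume.restrict (Ioi (0:ℝ))).withDensity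
      fun x => ENNReal.ofReal (x ^ (D - 1) * stieltjesFactor c D ν x)) =
      ∫⁻ y, ENNReal.ofReal (c * Real.Gamma D * affineKernel s y ^ (-D)) ∂ν := by
  rw [lintegral_withDensity_eq_lintegral_mul₀ (aemeasurable_rpow_mul_stieltjesFactor hc hD ν)
    (by fun_prop)]
  have hker : Measurable fun p : ℝ × unitInterval => ENNReal.ofReal
      (p.1 ^ (D - 1) * Real.exp (-(s * p.1)) * (c * (1 - (p.2 : ℝ)) ^ (-D)) *
        Real.exp (p.1 * -((p.2 : ℝ) / (1 - p.2)))) := by fun_prop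
  have hx : ∀ x ∈ Ioi (0 : ℝ), ((fun x => ENNReal.ofReal (x ^ (D - 1) * stieltjesFactor c D ν x)) *
      fun x => ENNReal.ofReal (Real.exp (-(s * x)))) x =
      ∫⁻ y, ENNReal.ofReal (x ^ (D - 1) * Real.exp (-(s * x)) * (c * (1 - (y : ℝ)) ^ (-D)) *
        Real.exp (x * -((y : ℝ) / (1 - y)))) ∂ν := by
    intro x hx
    have hx0 : 0 ≤ x ^ (D - 1) := Real.rpow_nonneg (le_of_lt hx) _
    rw [Pi.mul_apply, ENNReal.ofReal_mul hx0, stieltjesFactor, ProbabilityTheory.mgf,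
      ofReal_integral_eq_lintegral_ofReal (integrable_exp_stieltjesTilt hc hD ν hx)
        (ae_of_all _ fun y => Real.exp_nonneg _), stieltjesTilt,
      lintegral_withDensity_eq_lintegral_mul _ (by fun_prop) (by fun_prop), mul_right_comm,
      ← ENNReal.ofReal_mul hx0, ← lintegral_const_mul _ (by fun_prop)]
    refine lintegral_congr fun y => ?_
    have hy1 : 0 ≤ 1 - (y : ℝ) := sub_nonneg.2 y.2.2
    rw [Pi.mul_apply, ← ENNReal.ofReal_mul (by positivity), ← ENNReal.ofReal_mul (by positivity)]
    congr 1
    ring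
  rw [setLIntegral_congr_fun measurableSet_Ioi hx,
    lintegral_lintegral_swap hker.aemeasurable]
  refine lintegral_congr_ae ?_
  have hne : ∀ᵐ y ∂ν, y ≠ 1 := by simpa [ae_iff] using hν
  filter_upwards [hne] with y hy
  have hy1 : 0 < 1 - (y : ℝ) :=
    sub_pos.2 (lt_of_le_of_ne y.2.2 fun h => hy (Subtype.ext h))
  have hr : 0 < s + (y : ℝ) / (1 - y) := add_pos_of_pos_of_nonneg hs (div_nonneg y.2.1 hy1.le)
  have hpt : ∀ x : ℝ, ENNReal.ofReal (x ^ (D - 1) * Real.exp (-(s * x)) *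
        (c * (1 - (y : ℝ)) ^ (-D)) * Real.exp (x * -((y : ℝ) / (1 - y)))) =
      ENNReal.ofReal (c * (1 - (y : ℝ)) ^ (-D)) *
        ENNReal.ofReal (x ^ (D - 1) * Real.exp (-((s + (y : ℝ) / (1 - y)) * x))) := by
    intro x
    rw [← ENNReal.ofReal_mul (by positivity)]
    congr 1
    rw [show -((s + (y : ℝ) / (1 - y)) * x) = -(s * x) + x * -((y : ℝ) / (1 - y)) by ring,
      Real.exp_add]
    ring
  simp_rw [hpt]
  rw [lintegral_const_mul _ (by fun_prop), lintegral_rpow_mul_exp_neg hD hr,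
    ← ENNReal.ofReal_mul (by positivity)]
  congr 1
  have : affineKernel s y = (1 - (y : ℝ)) * (s + (y : ℝ) / (1 - y)) := by
    unfold affineKernel; field_simp
  rw [this, Real.mul_rpow hy1.le hr.le]
  ring

/-- The image of a Thorin measure under `u ↦ u / (1 + u)`. -/
noncomputable def thorinImage (μ : Measure ℝ) : Measure unitInterval :=
  (μ.restrict (Ioi 0)).map fun u => projIcc 0 1 zero_le_one (u / (1 + u))

lemma measurable_projIcc_div_one_add :
    Measurable fun u : ℝ => projIcc (0 : ℝ) 1 zero_le_one (u / (1 + u)) :=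
  continuous_projIcc.measurable.comp (by fun_prop)

lemma thorinImage_real_univ (μ : Measure ℝ) :
    (thorinImage μ).real univ = μ.real (Ioi 0) := by
  rw [thorinImage, measureReal_def, Measure.map_apply measurable_projIcc_div_one_add .univ]
  simp [measureReal_def]

lemma integral_log_affineKernel_thorinImage {μ : Measure ℝ}
    (hμ : ∀ s : ℝ, 0 ≤ s → IntegrableOn (fun u => Real.log (1 + s / u)) (Ioi 0) μ)
    {s : ℝ} (hs : 0 < s) :
    ∫ y, Real.log (affineKernel s y) ∂(thorinImage μ) =
      (∫ u in Ioi (0 : ℝ), Real.log (1 + s / u) ∂μ) -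
        ∫ u in Ioi (0 : ℝ), Real.log (1 + 1 / u) ∂μ := by
  rw [thorinImage, integral_map measurable_projIcc_div_one_add.aemeasurable
    (continuous_log_affineKernel hs).aestronglyMeasurable,
    ← integral_sub (hμ s hs.le) (hμ 1 zero_le_one)]
  refine setIntegral_congr_fun measurableSet_Ioi fun u hu => ?_
  have hu : 0 < u := hu
  have hmem : u / (1 + u) ∈ Icc (0 : ℝ) 1 :=
    ⟨by positivity, (div_le_one (by positivity)).2 (by linarith)⟩
  simp only [projIcc_of_mem zero_le_one hmem]
  rw [← Real.log_div (by positivity) (by positivity)]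
  congr 1
  unfold affineKernel
  field_simp
  ring

/-- The Laplace transform of a nontrivial generalized gamma convolution vanishes at infinity. -/
lemma tendsto_exp_neg_integral_log {μ : Measure ℝ}
    (hμ : ∀ s : ℝ, 0 ≤ s → IntegrableOn (fun u => Real.log (1 + s / u)) (Ioi 0) μ)
    (hfin : μ (Ioi 0) ≠ ⊤) (hpos : μ (Ioi 0) ≠ 0) :
    Filter.Tendsto (fun s => Real.exp (-∫ u in Ioi (0 : ℝ), Real.log (1 + s / u) ∂μ))
      Filter.atTop (nhds 0) := by
  obtain ⟨n, hn⟩ : ∃ n : ℕ, μ (Ioc 0 (n : ℝ)) ≠ 0 := by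
    by_contra! h
    refine hpos (measure_mono_null (fun u hu => ?_) (measure_iUnion_null h))
    obtain ⟨n, hn⟩ := exists_nat_ge u
    exact mem_iUnion.2 ⟨n, hu, hn⟩
  have hsub : Ioc (0 : ℝ) n ⊆ Ioi 0 := fun u hu => hu.1
  have hlt : μ (Ioc 0 (n : ℝ)) ≠ ⊤ := measure_ne_top_of_subset hsub hfin
  have hn0 : (0 : ℝ) < n := by
    rcases Nat.eq_zero_or_pos n with rfl | h
    · simp at hn
    · exact_mod_cast h
  have hq : 0 < μ.real (Ioc 0 (n : ℝ)) := ENNReal.toReal_pos hn hlt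
  have hbase : Filter.Tendsto (fun s : ℝ => 1 + s / n) Filter.atTop Filter.atTop :=
    Filter.tendsto_atTop_add_const_left _ _ (Filter.tendsto_id.atTop_div_const hn0)
  refine squeeze_zero' (Filter.Eventually.of_forall fun s => Real.exp_nonneg _) ?_
    ((tendsto_rpow_neg_atTop hq).comp hbase)
  filter_upwards [Filter.eventually_gt_atTop 0] with s hs
  rw [Function.comp_apply, Real.rpow_def_of_pos (by positivity), mul_neg]
  gcongr
  calc Real.log (1 + s / n) * μ.real (Ioc 0 (n : ℝ))
      = ∫ _ in Ioc 0 (n : ℝ), Real.log (1 + s / n) ∂μ := by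
        rw [setIntegral_const, smul_eq_mul, mul_comm]
    _ ≤ ∫ u in Ioc 0 (n : ℝ), Real.log (1 + s / u) ∂μ := by
        refine setIntegral_mono_on (integrableOn_const hlt) ((hμ s hs.le).mono_set hsub)
          measurableSet_Ioc fun u hu => ?_
        have := hu.1
        have := hu.2
        gcongr
    _ ≤ ∫ u in Ioi (0 : ℝ), Real.log (1 + s / u) ∂μ := by
        refine setIntegral_mono_set (hμ s hs.le)
          (ae_restrict_of_forall_mem measurableSet_Ioi fun u hu => ?_) hsub.eventuallyLE
        have hu : 0 < u := hu
        exact Real.log_nonneg (by have : 0 < s / u := by positivity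
                                  linarith)

/-- The Laplace exponent of a generalized gamma convolution of Thorin mass `D` is, up to a
constant, a generalized Stieltjes transform of order `D` without mass at infinity. -/
lemma exists_stieltjes_of_thorin {μ : Measure ℝ}
    (hμ : ∀ s : ℝ, 0 ≤ s → IntegrableOn (fun u => Real.log (1 + s / u)) (Ioi 0) μ)
    (hfin : μ (Ioi 0) ≠ ⊤) (hpos : μ (Ioi 0) ≠ 0) :
    ∃ ν : ProbabilityMeasure unitInterval, (ν : Measure unitInterval) {1} = 0 ∧
      ∃ C : ℝ, 0 < C ∧ ∀ s : ℝ, 0 < s →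
        C * ∫ y, affineKernel s y ^ (-μ.real (Ioi 0)) ∂(ν : Measure unitInterval) =
          Real.exp (-∫ u in Ioi (0 : ℝ), Real.log (1 + s / u) ∂μ) := by
  have : IsFiniteMeasure (μ.restrict (Ioi 0)) := isFiniteMeasure_restrict.2 hfin
  have : IsFiniteMeasure (thorinImage μ) := by unfold thorinImage; infer_instance
  obtain ⟨ν, hν⟩ := exists_markovKrein (thorinImage μ)
  rw [thorinImage_real_univ] at hν
  set C := Real.exp (-∫ u in Ioi (0 : ℝ), Real.log (1 + 1 / u) ∂μ) with hC
  have hC0 : 0 < C := Real.exp_pos _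
  have hφ : ∀ s : ℝ, 0 < s →
      C * ∫ y, affineKernel s y ^ (-μ.real (Ioi 0)) ∂(ν : Measure unitInterval) =
        Real.exp (-∫ u in Ioi (0 : ℝ), Real.log (1 + s / u) ∂μ) := by
    intro s hs
    rw [hν s hs, integral_log_affineKernel_thorinImage hμ hs, hC, ← Real.exp_add]
    congr 1
    ring
  refine ⟨ν, ?_, C, hC0, hφ⟩
  have hle : C * (ν : Measure unitInterval).real {1} ≤ 0 := by
    refine ge_of_tendsto (tendsto_exp_neg_integral_log hμ hfin hpos) ?_
    filter_upwards [Filter.eventually_gt_atTop 0] with s hs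
    rw [← hφ s hs]
    refine mul_le_mul_of_nonneg_left ?_ hC0.le
    rw [← integral_indicator_one (measurableSet_singleton 1)]
    have hcont := continuous_affineKernel_rpow hs (-μ.real (Ioi 0))
    refine integral_mono ((integrable_const 1).indicator (measurableSet_singleton 1))
      (hcont.integrable_of_hasCompactSupport (HasCompactSupport.of_compactSpace _)) fun y => ?_
    by_cases hy : y = 1
    · simp [hy, affineKernel]
    · simpa [hy] using Real.rpow_nonneg (affineKernel_pos hs y.2).le _
  have hzero : (ν : Measure unitInterval).real {1} = 0 :=
    le_antisymm (nonpos_of_mul_nonpos_right hle hC0) measureReal_nonneg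
  exact (measureReal_eq_zero_iff).1 hzero

/-- Every GGC with finite positive Thorin mass `D` has a density on `(0,∞)` of the canonical
form `f(x) = x^(D-1) h(x)` with `h` completely monotone. -/
theorem ggc_density_canonical_form {Ω : Type*} [MeasurableSpace Ω]
    (P : Measure Ω) [IsProbabilityMeasure P] (X : Ω → ℝ) (hX : Measurable X)
    (μ : Measure ℝ) (hGGC : IsGGC P X μ)
    (hfin : μ (Set.Ioi (0:ℝ)) ≠ ⊤)
    (D : ℝ) (hD : D = (μ (Set.Ioi (0:ℝ))).toReal) (hDpos : 0 < D) :
    ∃ h : ℝ → ℝ, CompletelyMonotoneOn h (Set.Ioi 0) ∧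
      Measure.map X P =
        (volume.restrict (Set.Ioi (0:ℝ))).withDensity
          (fun x => ENNReal.ofReal (x ^ (D - 1) * h x)) := by
  obtain ⟨hX0, hint, hlap⟩ := hGGC
  have hD' : D = μ.real (Ioi 0) := hD
  have hpos : μ (Ioi 0) ≠ 0 := fun h => by simp [hD, h] at hDpos
  obtain ⟨ν, hν1, C, hC, hφ⟩ := exists_stieltjes_of_thorin hint hfin hpos
  rw [← hD'] at hφ
  have hΓ := Real.Gamma_pos_of_pos hDpos
  have hc : 0 ≤ C / Real.Gamma D := by positivity
  refine ⟨stieltjesFactor (C / Real.Gamma D) D ν,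
    completelyMonotoneOn_stieltjesFactor hc hDpos ν, ?_⟩
  have hlapX : ∀ s : ℝ, 0 < s → ∫⁻ x, ENNReal.ofReal (Real.exp (-(s * x))) ∂(Measure.map X P) =
      ENNReal.ofReal (Real.exp (-∫ u in Ioi (0 : ℝ), Real.log (1 + s / u) ∂μ)) := by
    intro s hs
    rw [lintegral_map (by fun_prop) hX, ← hlap s hs.le, ofReal_integral_eq_lintegral_ofReal
      (Integrable.of_integral_ne_zero (by rw [hlap s hs.le]; exact (Real.exp_pos _).ne'))
      (ae_of_all _ fun ω => Real.exp_nonneg _)]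
  refine measure_ext_of_lintegral_exp
    ((ae_map_iff hX.aemeasurable measurableSet_Ici).2 (ae_of_all _ hX0))
    ((withDensity_absolutelyContinuous _ _).ae_le
      (ae_restrict_of_forall_mem measurableSet_Ioi fun x hx => le_of_lt hx))
    (fun s hs => by simp [hlapX s hs]) fun s hs => ?_
  rw [hlapX s hs, lintegral_exp_neg_mul_stieltjesFactor hc hDpos ν hν1 hs,
    div_mul_cancel₀ _ hΓ.ne', ← hφ s hs, ← integral_const_mul,
    ofReal_integral_eq_lintegral_ofReal]
  · exact ((continuous_affineKernel_rpow hs (-D)).integrable_of_hasCompactSupport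
      (HasCompactSupport.of_compactSpace _)).const_mul C
  · exact ae_of_all _ fun y => mul_nonneg hC.le (Real.rpow_nonneg (affineKernel_pos hs y.2).le _)
end

section
/- Let X be a generalized gamma convolution (GGC) with Thorin measure μ, Thorin mass 0 < D = μ((0,∞)) < ∞, and density f(x) = x^(D−1)·h(x) on (0,∞) with h completely monotone. If ∫₀^∞ |log u| μ(du) < ∞, then h(0+) = lim_{x→0+} h(x) is finite and h(0+) = (1/Γ(D))·exp(∫₀^∞ (log u) μ(du)). -/
open MeasureTheory Real Set Filter

/-- A completely monotone function on `(0, ∞)` is antitone there. -/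
lemma CompletelyMonotoneOn.antitoneOn_Ioi {h : ℝ → ℝ}
    (hcm : CompletelyMonotoneOn h (Set.Ioi 0)) : AntitoneOn h (Set.Ioi 0) := by
  have hdiff : ∀ x ∈ Set.Ioi (0 : ℝ), DifferentiableAt ℝ h x := fun x hx =>
    (hcm.1 x hx).differentiableAt (by simp)
  refine antitoneOn_of_deriv_nonpos (convex_Ioi 0)
    (fun x hx => (hdiff x hx).continuousAt.continuousWithinAt) ?_ ?_
  · intro x hx
    rw [interior_Ioi] at hx
    exact (hdiff x hx).differentiableWithinAt
  · intro x hx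
    rw [interior_Ioi] at hx
    have := hcm.2 1 x hx
    rw [iteratedDeriv_one] at this
    linarith

/-- Linear substitution in a lower Lebesgue integral over `(0, ∞)`. -/
lemma lintegral_Ioi_eq_mul_lintegral_comp_mul_left {c : ℝ} (hc : 0 < c) (f : ℝ → ENNReal) :
    ∫⁻ x in Set.Ioi 0, f x = ENNReal.ofReal c * ∫⁻ y in Set.Ioi 0, f (c * y) := by
  have himage : (fun y : ℝ => c * y) '' Set.Ioi 0 = Set.Ioi 0 := by
    rw [Set.image_mul_left_Ioi hc, mul_zero]
  have hsubst := lintegral_image_eq_lintegral_abs_deriv_mul (s := Set.Ioi (0 : ℝ))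
    measurableSet_Ioi (f := fun y => c * y) (f' := fun _ => c)
    (fun x _ => by simpa using ((hasDerivAt_id x).const_mul c).hasDerivWithinAt)
    (mul_right_injective₀ hc.ne').injOn f
  rw [himage] at hsubst
  rw [hsubst, abs_of_pos hc, lintegral_const_mul' _ _ ENNReal.ofReal_ne_top]

/-- The Laplace transform of a random variable with density `x ^ (D - 1) * h x`, after the
substitution `y = s * x`. -/
lemma lintegral_gamma_mul_comp_div_eq {Ω : Type*} [MeasurableSpace Ω]
    {P : Measure Ω} [IsProbabilityMeasure P] {X : Ω → ℝ} (hX : Measurable X)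
    (hX0 : ∀ ω, 0 ≤ X ω) {D : ℝ} {h : ℝ → ℝ}
    (hh : AEMeasurable h (volume.restrict (Set.Ioi 0)))
    (hdens : Measure.map X P =
      (volume.restrict (Set.Ioi (0:ℝ))).withDensity
        (fun x => ENNReal.ofReal (x ^ (D - 1) * h x))) {s : ℝ} (hs : 0 < s) :
    ∫⁻ y in Set.Ioi 0, ENNReal.ofReal (Real.exp (-y) * y ^ (D - 1)) * ENNReal.ofReal (h (y / s)) =
      ENNReal.ofReal (s ^ D * ∫ ω, Real.exp (-(s * X ω)) ∂P) := by
  have hexp : Measurable fun x : ℝ => ENNReal.ofReal (Real.exp (-(s * x))) := by fun_prop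
  have hint : Integrable (fun ω => Real.exp (-(s * X ω))) P := by
    refine Integrable.of_bound (by fun_prop) 1 (ae_of_all _ fun ω => ?_)
    rw [Real.norm_eq_abs, abs_of_pos (Real.exp_pos _), Real.exp_le_one_iff]
    have := mul_nonneg hs.le (hX0 ω)
    linarith
  have hf : AEMeasurable (fun x => ENNReal.ofReal (x ^ (D - 1) * h x))
      (volume.restrict (Set.Ioi 0)) :=
    ((Measurable.aemeasurable (by fun_prop)).mul hh).ennreal_ofReal
  rw [ENNReal.ofReal_mul (by positivity), ofReal_integral_eq_lintegral_ofReal hint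
      (ae_of_all _ fun ω => (Real.exp_pos _).le),
    ← lintegral_map (f := fun x : ℝ => ENNReal.ofReal (Real.exp (-(s * x)))) hexp hX, hdens,
    lintegral_withDensity_eq_lintegral_mul₀ hf hexp.aemeasurable,
    lintegral_Ioi_eq_mul_lintegral_comp_mul_left (inv_pos.2 hs)
      ((fun x => ENNReal.ofReal (x ^ (D - 1) * h x)) * _), ← mul_assoc,
    ← ENNReal.ofReal_mul (by positivity), ← lintegral_const_mul' _ _ ENNReal.ofReal_ne_top]
  refine setLIntegral_congr_fun measurableSet_Ioi fun y hy => ?_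
  have hy : 0 < y := hy
  have hcancel : s * (s⁻¹ * y) = y := by field_simp
  have hpow : s ^ D * s⁻¹ * (s⁻¹ * y) ^ (D - 1) = y ^ (D - 1) := by
    rw [Real.mul_rpow (inv_pos.2 hs).le hy.le, Real.inv_rpow hs.le, Real.rpow_sub_one hs.ne']
    have := (Real.rpow_pos_of_pos hs D).ne'
    field_simp
  simp only [Pi.mul_apply, hcancel]
  rw [← ENNReal.ofReal_mul (by positivity), mul_comm (ENNReal.ofReal (_ * h _)),
    ← ENNReal.ofReal_mul (by positivity), ← ENNReal.ofReal_mul (by positivity), ← hpow,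
    div_eq_inv_mul]
  congr 1
  ring

/-- The scaled Laplace transform `s ^ D * exp (-∫ log (1 + s / u) dμ)` of a generalized gamma
convolution converges to `exp (∫ log u dμ)`. -/
lemma tendsto_rpow_mul_exp_neg_integral_log {μ : Measure ℝ}
    (hfin : μ (Set.Ioi (0:ℝ)) ≠ ⊤)
    (hint : ∀ s : ℝ, 0 ≤ s → IntegrableOn (fun u => Real.log (1 + s / u)) (Set.Ioi 0) μ)
    (hlog : IntegrableOn (fun u => |Real.log u|) (Set.Ioi 0) μ) :
    Tendsto (fun s : ℝ => s ^ (μ (Set.Ioi (0:ℝ))).toReal *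
        Real.exp (-(∫ u in Set.Ioi (0:ℝ), Real.log (1 + s / u) ∂μ))) atTop
      (nhds (Real.exp (∫ u in Set.Ioi (0:ℝ), Real.log u ∂μ))) := by
  have : IsFiniteMeasure (μ.restrict (Set.Ioi 0)) := ⟨by simpa using hfin.lt_top⟩
  have hlim : Tendsto (fun s : ℝ => ∫ u in Set.Ioi (0:ℝ), (Real.log s - Real.log (1 + s / u)) ∂μ)
      atTop (nhds (∫ u in Set.Ioi (0:ℝ), Real.log u ∂μ)) := by
    refine tendsto_integral_filter_of_dominated_convergence
      (fun u => |Real.log u| + (Real.log 2 + |Real.log u|))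
      (Eventually.of_forall fun s => (Measurable.aestronglyMeasurable (by fun_prop)))
      ?_ (hlog.add ((integrable_const _).add hlog)) ?_
    · filter_upwards [eventually_ge_atTop (1 : ℝ)] with s hs
      refine (ae_restrict_iff' measurableSet_Ioi).2 (ae_of_all _ fun u hu => ?_)
      have hu : 0 < u := hu
      have hs0 : 0 < s := by linarith
      have heq : Real.log s - Real.log (1 + s / u) = Real.log u - Real.log (1 + u / s) := by
        rw [show 1 + s / u = (1 + u / s) * s / u by field_simp; ring,
          Real.log_div (by positivity) hu.ne', Real.log_mul (by positivity) hs0.ne']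
        ring
      have hlower : 0 ≤ Real.log (1 + u / s) :=
        Real.log_nonneg (le_add_of_nonneg_right (by positivity))
      have hupper : Real.log (1 + u / s) ≤ Real.log 2 + |Real.log u| := by
        have hus : u / s ≤ u := div_le_self hu.le hs
        have hule : u ≤ Real.exp |Real.log u| := by
          simpa [Real.exp_log hu] using Real.exp_le_exp.2 (le_abs_self (Real.log u))
        have hone : 1 ≤ Real.exp |Real.log u| := Real.one_le_exp (abs_nonneg _)
        calc Real.log (1 + u / s) ≤ Real.log (2 * Real.exp |Real.log u|) :=
              Real.log_le_log (by positivity) (by linarith)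
          _ = Real.log 2 + |Real.log u| := by
              rw [Real.log_mul two_ne_zero (Real.exp_pos _).ne', Real.log_exp]
      rw [heq]
      refine (abs_sub _ _).trans ?_
      rw [abs_of_nonneg hlower]
      gcongr
    · refine (ae_restrict_iff' measurableSet_Ioi).2 (ae_of_all _ fun u hu => ?_)
      have hu : 0 < u := hu
      have hdiv : Tendsto (fun s : ℝ => Real.log u - Real.log (1 + u / s)) atTop
          (nhds (Real.log u - Real.log (1 + 0))) :=
        tendsto_const_nhds.sub (Tendsto.log
          (tendsto_const_nhds.add (tendsto_const_nhds.div_atTop tendsto_id)) (by norm_num))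
      rw [add_zero, Real.log_one, sub_zero] at hdiv
      refine hdiv.congr' ?_
      filter_upwards [eventually_gt_atTop (0 : ℝ)] with s hs
      rw [show 1 + s / u = (1 + u / s) * s / u by field_simp; ring,
          Real.log_div (by positivity) hu.ne', Real.log_mul (by positivity) hs.ne']
      ring
  refine ((Real.continuous_exp.tendsto _).comp hlim).congr' ?_
  filter_upwards [eventually_gt_atTop (0 : ℝ)] with s hs
  rw [Function.comp_apply, integral_sub (integrable_const _) (hint s hs.le), integral_const,
    sub_eq_add_neg, Real.exp_add, Real.rpow_def_of_pos hs]
  simp [Measure.real, mul_comm]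

/-- Abelian limit: for `h` antitone on `(0, ∞)`, the integrals of `h (y / n)` against the gamma
weight converge to `Γ(D)` times the limit of `h` at `0`, taken in `[0, ∞]`. -/
lemma tendsto_lintegral_gamma_mul_comp_div {D : ℝ} (hD : 0 < D) {h : ℝ → ℝ}
    (hanti : AntitoneOn h (Set.Ioi 0)) {H : ENNReal}
    (hH : Tendsto (fun x => ENNReal.ofReal (h x)) (nhdsWithin 0 (Set.Ioi 0)) (nhds H)) :
    Tendsto (fun n : ℕ => ∫⁻ y in Set.Ioi 0,
        ENNReal.ofReal (Real.exp (-y) * y ^ (D - 1)) * ENNReal.ofReal (h (y / (n + 1 : ℝ)))) atTop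
      (nhds (ENNReal.ofReal (Real.Gamma D) * H)) := by
  have hgamma : ENNReal.ofReal (Real.Gamma D) * H =
      ∫⁻ y in Set.Ioi 0, ENNReal.ofReal (Real.exp (-y) * y ^ (D - 1)) * H := by
    rw [lintegral_mul_const _ (by fun_prop), Real.Gamma_eq_integral hD,
      ofReal_integral_eq_lintegral_ofReal (Real.GammaIntegral_convergent hD)]
    refine (ae_restrict_iff' measurableSet_Ioi).2 (ae_of_all _ fun y hy => ?_)
    have hy : 0 < y := hy
    simp only [Pi.zero_apply]
    positivity
  rw [hgamma]
  refine lintegral_tendsto_of_tendsto_of_monotone (fun n => ?_) ?_ ?_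
  · have hpos : (0 : ℝ) < n + 1 := by positivity
    have hcomp : AntitoneOn (fun y => h (y / (n + 1 : ℝ))) (Set.Ioi 0) := fun x hx y hy hxy =>
      hanti (div_pos hx hpos) (div_pos hy hpos) (by gcongr)
    exact (Measurable.aemeasurable (by fun_prop)).mul
      (aemeasurable_restrict_of_antitoneOn measurableSet_Ioi hcomp).ennreal_ofReal
  · refine (ae_restrict_iff' measurableSet_Ioi).2 (ae_of_all _ fun y hy m n hmn => ?_)
    have hy : 0 < y := hy
    have hle : h (y / (m + 1 : ℝ)) ≤ h (y / (n + 1 : ℝ)) :=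
      hanti (show 0 < y / (n + 1 : ℝ) by positivity) (show 0 < y / (m + 1 : ℝ) by positivity)
        (by gcongr)
    dsimp only
    gcongr
  · refine (ae_restrict_iff' measurableSet_Ioi).2 (ae_of_all _ fun y hy => ?_)
    have hy : 0 < y := hy
    refine ENNReal.Tendsto.const_mul (hH.comp (tendsto_nhdsWithin_iff.2 ⟨?_, ?_⟩))
      (Or.inr ENNReal.ofReal_ne_top)
    · exact tendsto_const_nhds.div_atTop
        (tendsto_atTop_add_const_right _ _ tendsto_natCast_atTop_atTop)
    · exact Eventually.of_forall fun n => show 0 < y / (n + 1 : ℝ) by positivity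

/-- For a GGC with finite positive Thorin mass `D`, canonical density `f(x) = x^(D-1) h(x)` and
`∫₀^∞ |log u| μ(du) < ∞`, the limit `h(0+)` is finite and equals
`(1/Γ(D)) exp (∫₀^∞ (log u) μ(du))`. -/
theorem ggc_h_zero_limit {Ω : Type*} [MeasurableSpace Ω]
    (P : Measure Ω) [IsProbabilityMeasure P] (X : Ω → ℝ) (hX : Measurable X)
    (μ : Measure ℝ) (hGGC : IsGGC P X μ)
    (hfin : μ (Set.Ioi (0:ℝ)) ≠ ⊤)
    (D : ℝ) (hD : D = (μ (Set.Ioi (0:ℝ))).toReal) (hDpos : 0 < D)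
    (h : ℝ → ℝ) (hcm : CompletelyMonotoneOn h (Set.Ioi 0))
    (hdens : Measure.map X P =
      (volume.restrict (Set.Ioi (0:ℝ))).withDensity
        (fun x => ENNReal.ofReal (x ^ (D - 1) * h x)))
    (hlog : IntegrableOn (fun u => |Real.log u|) (Set.Ioi 0) μ) :
    Tendsto h (nhdsWithin 0 (Set.Ioi 0))
      (nhds ((1 / Real.Gamma D) *
        Real.exp (∫ u in Set.Ioi (0:ℝ), Real.log u ∂μ))) := by
  have hanti := hcm.antitoneOn_Ioi
  have hnonneg : ∀ x ∈ Set.Ioi (0 : ℝ), 0 ≤ h x := fun x hx => by simpa using hcm.2 0 x hx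
  have hΓ : 0 < Real.Gamma D := Real.Gamma_pos_of_pos hDpos
  set C := Real.exp (∫ u in Set.Ioi (0:ℝ), Real.log u ∂μ)
  obtain ⟨H, hH⟩ : ∃ H, Tendsto (fun x => ENNReal.ofReal (h x)) (nhdsWithin 0 (Set.Ioi 0))
      (nhds H) :=
    ⟨_, AntitoneOn.tendsto_nhdsGT
      (fun x hx y hy hxy => ENNReal.ofReal_le_ofReal (hanti hx hy hxy)) (OrderTop.bddAbove _)⟩
  have hlaplace : Tendsto (fun n : ℕ => ∫⁻ y in Set.Ioi 0,
      ENNReal.ofReal (Real.exp (-y) * y ^ (D - 1)) * ENNReal.ofReal (h (y / (n + 1 : ℝ)))) atTop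
      (nhds (ENNReal.ofReal C)) := by
    have hshift : Tendsto (fun n : ℕ => (n + 1 : ℝ)) atTop atTop :=
      tendsto_atTop_add_const_right _ _ tendsto_natCast_atTop_atTop
    refine (ENNReal.tendsto_ofReal
      ((tendsto_rpow_mul_exp_neg_integral_log hfin hGGC.2.1 hlog).comp hshift)).congr fun n => ?_
    have hpos : (0 : ℝ) < n + 1 := by positivity
    rw [lintegral_gamma_mul_comp_div_eq hX hGGC.1
      (aemeasurable_restrict_of_antitoneOn measurableSet_Ioi hanti) hdens hpos,
      hGGC.2.2 _ hpos.le, hD]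
    rfl
  have hmul : ENNReal.ofReal (Real.Gamma D) * H = ENNReal.ofReal C :=
    tendsto_nhds_unique (tendsto_lintegral_gamma_mul_comp_div hDpos hanti hH) hlaplace
  have hHeq : H = ENNReal.ofReal ((1 / Real.Gamma D) * C) := by
    rw [one_div, ENNReal.ofReal_mul (by positivity), ← hmul, ← mul_assoc,
      ← ENNReal.ofReal_mul (by positivity), inv_mul_cancel₀ hΓ.ne', ENNReal.ofReal_one, one_mul]
  rw [hHeq] at hH
  have hreal := (ENNReal.tendsto_toReal ENNReal.ofReal_ne_top).comp hH
  rw [ENNReal.toReal_ofReal (by positivity)] at hreal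
  refine hreal.congr' ?_
  filter_upwards [self_mem_nhdsWithin] with x hx
  exact ENNReal.toReal_ofReal (hnonneg x hx)
end

section
/- Let X be a generalized gamma convolution (GGC) with Thorin mass 0 < D < ∞. Then X admits a gamma variance-mixture representation: there exists a nonnegative random variable A, independent of a Gamma(D,1)-distributed random variable Z, such that X has the same distribution as A·Z. Hence every GGC fading channel with finite diversity order D is equivalent to a Nakagami-m fading channel with m = D subject to independent shadowing. -/
open MeasureTheory ProbabilityTheory Real Set

open Filter Topology

theorem NNReal.measure_ext_of_integral_exp_neg {m₁ m₂ : Measure NNReal} [IsFiniteMeasure m₁]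
    [IsFiniteMeasure m₂]
    (h : ∀ n : ℕ, ∫ x : NNReal, rexp (-(n * x)) ∂m₁ = ∫ x : NNReal, rexp (-(n * x)) ∂m₂) :
    m₁ = m₂ := by
  let f : BoundedContinuousFunction NNReal ℝ :=
    BoundedContinuousFunction.ofNormedAddCommGroup (fun x : NNReal => rexp (-(x : ℝ)))
      (by fun_prop) 1 (fun x => by simp [abs_of_pos (Real.exp_pos _)])
  have hf (x : NNReal) : f x = rexp (-(x : ℝ)) := rfl
  let A : StarSubalgebra ℝ (BoundedContinuousFunction NNReal ℝ) :=
    { Algebra.adjoin ℝ {f} with star_mem' := fun {a} ha => ha }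
  have hA : ∀ g ∈ A, ∃ p : Polynomial ℝ, Polynomial.aeval f p = g := fun g hg => by
    have : g ∈ Algebra.adjoin ℝ {f} := hg
    rwa [Algebra.adjoin_singleton_eq_range_aeval] at this
  refine ext_of_forall_mem_subalgebra_integral_eq_of_polish (𝕜 := ℝ) (A := A) ?_ fun g hg => ?_
  · intro x y hxy
    refine ⟨f, ⟨f.toContinuousMap, ⟨f, Algebra.subset_adjoin rfl, rfl⟩, rfl⟩, ?_⟩
    simpa [hf] using hxy
  · obtain ⟨p, rfl⟩ := hA g hg
    induction p using Polynomial.induction_on' with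
    | add p q hp hq =>
      have hi (m : Measure NNReal) [IsFiniteMeasure m] (r : Polynomial ℝ) :
          Integrable (Polynomial.aeval f r) m := BoundedContinuousFunction.integrable m _
      have key (r : Polynomial ℝ) : Polynomial.aeval f r ∈ A := by
        change _ ∈ Algebra.adjoin ℝ {f}
        rw [Algebra.adjoin_singleton_eq_range_aeval]
        exact ⟨r, rfl⟩
      simp only [map_add, BoundedContinuousFunction.coe_add, Pi.add_apply]
      rw [integral_add (hi m₁ p) (hi m₁ q), integral_add (hi m₂ p) (hi m₂ q), hp (key p),
        hq (key q)]
    | monomial n c =>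
      have (x : NNReal) : Polynomial.aeval f (Polynomial.monomial n c) x
          = c * rexp (-(n * x)) := by
        simp [Polynomial.aeval_monomial, hf, ← Real.exp_nat_mul]
      simp only [this, integral_const_mul, h n]

theorem Real.measure_ext_of_integral_exp_neg {m₁ m₂ : Measure ℝ} [IsFiniteMeasure m₁]
    [IsFiniteMeasure m₂] (h₁ : ∀ᵐ x ∂m₁, 0 ≤ x) (h₂ : ∀ᵐ x ∂m₂, 0 ≤ x)
    (h : ∀ n : ℕ, ∫ x, rexp (-(n * x)) ∂m₁ = ∫ x, rexp (-(n * x)) ∂m₂) : m₁ = m₂ := by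
  have key (m : Measure ℝ) (hm : ∀ᵐ x ∂m, 0 ≤ x) :
      (m.map Real.toNNReal).map ((↑) : NNReal → ℝ) = m := by
    rw [Measure.map_map (by fun_prop) (by fun_prop)]
    nth_rewrite 2 [← Measure.map_id (μ := m)]
    exact Measure.map_congr (hm.mono fun x hx => Real.coe_toNNReal x hx)
  rw [← key m₁ h₁, ← key m₂ h₂]
  congr 1
  refine NNReal.measure_ext_of_integral_exp_neg fun n => ?_
  have key2 (m : Measure ℝ) (hm : ∀ᵐ x ∂m, 0 ≤ x) :
      ∫ x : NNReal, rexp (-(n * x)) ∂(m.map Real.toNNReal) = ∫ x, rexp (-(n * x)) ∂m := by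
    rw [integral_map (by fun_prop) (by fun_prop)]
    exact integral_congr_ae (hm.mono fun x hx => by simp [Real.coe_toNNReal x hx])
  rw [key2 m₁ h₁, key2 m₂ h₂, h n]

theorem ae_gammaMeasure_nonneg (a r : ℝ) : ∀ᵐ z ∂gammaMeasure a r, 0 ≤ z := by
  have hm : Measurable (gammaPDF a r) := (measurable_gammaPDFReal a r).ennreal_ofReal
  rw [gammaMeasure, ae_withDensity_iff hm]
  refine ae_of_all _ fun x hx => ?_
  contrapose! hx
  exact gammaPDF_of_neg hx

theorem integral_exp_neg_mul_gammaMeasure_s17 {D c : ℝ} (hD : 0 < D) (hc : 0 ≤ c) :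
    ∫ z, rexp (-(c * z)) ∂gammaMeasure D 1 = (1 + c) ^ (-D) := by
  have hm : Measurable (gammaPDF D 1) := (measurable_gammaPDFReal D 1).ennreal_ofReal
  rw [gammaMeasure, integral_withDensity_eq_integral_toReal_smul hm
    (ae_of_all _ fun x => ENNReal.ofReal_lt_top)]
  have h (x : ℝ) : (gammaPDF D 1 x).toReal • rexp (-(c * x)) =
      (Ici (0 : ℝ)).indicator
        (fun x => (Real.Gamma D)⁻¹ * (x ^ (D - 1) * rexp (-((1 + c) * x)))) x := by
    have hpos : 0 ≤ gammaPDFReal D 1 x := gammaPDFReal_nonneg hD one_pos x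
    rw [gammaPDF, ENNReal.toReal_ofReal hpos, gammaPDFReal, indicator]
    simp only [mem_Ici, smul_eq_mul]
    split_ifs
    · rw [show -((1 + c) * x) = -(1 * x) + -(c * x) by ring, Real.exp_add, Real.one_rpow]
      ring
    · simp
  simp only [h]
  rw [integral_indicator measurableSet_Ici, integral_Ici_eq_integral_Ioi, integral_const_mul,
    Real.integral_rpow_mul_exp_neg_mul_Ioi hD (by positivity), one_div,
    Real.inv_rpow (by positivity), Real.rpow_neg (by positivity)]
  field_simp [(Real.Gamma_pos_of_pos hD).ne']

theorem integral_betaMeasure {α β : ℝ} (hα : 0 < α) (hβ : 0 < β) (f : ℝ → ℝ) :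
    ∫ t, f t ∂betaMeasure α β = ∫ t in Ioo 0 1, betaPDFReal α β t * f t := by
  have hm : Measurable (betaPDF α β) := (measurable_betaPDFReal α β).ennreal_ofReal
  rw [betaMeasure, integral_withDensity_eq_integral_toReal_smul hm
    (ae_of_all _ fun x => ENNReal.ofReal_lt_top), ← integral_indicator measurableSet_Ioo]
  congr 1 with t
  by_cases ht : t ∈ Ioo (0 : ℝ) 1
  · rw [indicator_of_mem ht, betaPDF, ENNReal.toReal_ofReal (betaPDFReal_pos ht.1 ht.2 hα hβ).le,
      smul_eq_mul]
  · rw [indicator_of_notMem ht, betaPDF, betaPDFReal, if_neg (show ¬(0 < t ∧ t < 1) from ht)]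
    simp

theorem ae_betaMeasure_mem_Ioo (α β : ℝ) : ∀ᵐ t ∂betaMeasure α β, t ∈ Ioo (0 : ℝ) 1 := by
  have hm : Measurable (betaPDF α β) := (measurable_betaPDFReal α β).ennreal_ofReal
  rw [betaMeasure, ae_withDensity_iff hm]
  refine ae_of_all _ fun t ht => ?_
  contrapose! ht
  rw [betaPDF, betaPDFReal, if_neg (show ¬(0 < t ∧ t < 1) from ht)]
  simp

/-- The Feynman parametrization of a product of two negative powers. -/
theorem integral_rpow_betaMeasure {α β p q : ℝ} (hα : 0 < α) (hβ : 0 < β) (hp : 0 < p)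
    (hq : 0 < q) :
    ∫ t, (t * p + (1 - t) * q) ^ (-(α + β)) ∂betaMeasure α β = p ^ (-α) * q ^ (-β) := by
  have := isProbabilityMeasureBeta hα hβ
  have h1 : ∫ t in Ioo 0 1, betaPDFReal α β t = 1 := by
    have := integral_betaMeasure hα hβ (fun _ => 1)
    simpa using this.symm
  have hd {t : ℝ} (ht : t ∈ Ioo (0 : ℝ) 1) : 0 < t * p + (1 - t) * q := by
    have := mul_pos ht.1 hp
    have := mul_pos (sub_pos.2 ht.2) hq
    positivity
  let φ : ℝ → ℝ := fun t => t * p / (t * p + (1 - t) * q)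
  have hφ (t : ℝ) (ht : t ∈ Ioo (0 : ℝ) 1) :
      HasDerivWithinAt φ (p * q / (t * p + (1 - t) * q) ^ 2) (Ioo 0 1) t := by
    have h2 : HasDerivAt (fun t : ℝ => t * p) p t := by
      simpa using (hasDerivAt_id t).mul_const p
    have h3 : HasDerivAt (fun t : ℝ => (1 - t) * q) (-q) t := by
      simpa using ((hasDerivAt_id t).const_sub 1).mul_const q
    have := (h2.div (h2.add h3) (hd ht).ne').hasDerivWithinAt (s := Ioo 0 1)
    refine this.congr_deriv (congrArg (· / _) ?_)
    change p * (t * p + (1 - t) * q) - t * p * (p + -q) = p * q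
    ring
  have hinj : InjOn φ (Ioo 0 1) := by
    intro t ht u hu htu
    simp only [φ] at htu
    rw [div_eq_div_iff (hd ht).ne' (hd hu).ne'] at htu
    have : p * q * (t - u) = 0 := by linear_combination htu
    simpa [hp.ne', hq.ne', sub_eq_zero] using this
  have himg : φ '' Ioo 0 1 = Ioo 0 1 := by
    ext x
    constructor
    · rintro ⟨t, ht, rfl⟩
      refine ⟨div_pos (mul_pos ht.1 hp) (hd ht), (div_lt_one (hd ht)).2 ?_⟩
      have := mul_pos (sub_pos.2 ht.2) hq
      linarith
    · intro hx
      have h4 : 0 < x * q + (1 - x) * p := by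
        have := mul_pos hx.1 hq
        have := mul_pos (sub_pos.2 hx.2) hp
        positivity
      refine ⟨x * q / (x * q + (1 - x) * p), ⟨div_pos (mul_pos hx.1 hq) h4,
        (div_lt_one h4).2 ?_⟩, ?_⟩
      · have := mul_pos (sub_pos.2 hx.2) hp
        linarith
      · simp only [φ]
        have h5 : 1 - x * q / (x * q + (1 - x) * p) = (1 - x) * p / (x * q + (1 - x) * p) := by
          field_simp
          ring
        rw [h5]
        have h6 : x * q / (x * q + (1 - x) * p) * p + (1 - x) * p / (x * q + (1 - x) * p) * q
            = p * q / (x * q + (1 - x) * p) := by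
          field_simp
          ring
        rw [h6]
        field_simp
  have hcv := integral_image_eq_integral_abs_deriv_smul measurableSet_Ioo hφ hinj
    (betaPDFReal α β)
  rw [himg, h1] at hcv
  have hcv2 : (1 : ℝ) = ∫ t in Ioo 0 1,
      p ^ α * q ^ β * (betaPDFReal α β t * (t * p + (1 - t) * q) ^ (-(α + β))) := by
    refine hcv.trans (setIntegral_congr_fun measurableSet_Ioo fun t ht => ?_)
    have hd' := hd ht
    have hφt : φ t ∈ Ioo (0 : ℝ) 1 := himg ▸ mem_image_of_mem φ ht
    have h7 : 1 - φ t = (1 - t) * q / (t * p + (1 - t) * q) := by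
      simp only [φ]
      field_simp
      ring
    have ht0 := ht.1
    have ht1 : 0 < 1 - t := sub_pos.2 ht.2
    simp only [betaPDFReal, smul_eq_mul]
    rw [if_pos (show 0 < φ t ∧ φ t < 1 from hφt),
      if_pos (show 0 < t ∧ t < 1 from ht), h7, abs_of_pos (by positivity)]
    simp only [φ]
    generalize hdd : t * p + (1 - t) * q = d at hd' ⊢
    rw [Real.div_rpow (by positivity) hd'.le, Real.div_rpow (by positivity) hd'.le,
      Real.mul_rpow ht0.le hp.le, Real.mul_rpow ht1.le hq.le, Real.rpow_neg hd'.le,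
      Real.rpow_add hd', Real.rpow_sub_one hp.ne', Real.rpow_sub_one hq.ne',
      Real.rpow_sub_one hd'.ne', Real.rpow_sub_one hd'.ne']
    field_simp
  rw [integral_const_mul] at hcv2
  rw [integral_betaMeasure hα hβ, Real.rpow_neg hp.le, Real.rpow_neg hq.le]
  have := Real.rpow_pos_of_pos hp α
  have := Real.rpow_pos_of_pos hq β
  field_simp
  linarith

/-- `F` is the Laplace transform of a nonnegative scale mixture of the `Gamma(D, 1)` law. -/
def IsGammaScaleMixture (D : ℝ) (F : ℝ → ℝ) : Prop :=
  ∃ ν : Measure ℝ, IsProbabilityMeasure ν ∧ (∀ᵐ a ∂ν, 0 ≤ a) ∧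
    ∀ s : ℝ, 0 ≤ s → ∫ a, (1 + s * a) ^ (-D) ∂ν = F s

theorem isGammaScaleMixture_rpow {D b : ℝ} (hb : 0 ≤ b) :
    IsGammaScaleMixture D fun s => (1 + s * b) ^ (-D) :=
  ⟨Measure.dirac b, inferInstance, by simpa [ae_dirac_eq] using hb, fun s _ => by simp⟩

theorem Real.rpow_neg_le_one {D x : ℝ} (hD : 0 < D) (hx : 1 ≤ x) : x ^ (-D) ≤ 1 :=
  Real.rpow_le_one_of_one_le_of_nonpos hx (by linarith)

theorem IsGammaScaleMixture.mul_rpow {α β b : ℝ} {F : ℝ → ℝ} (hF : IsGammaScaleMixture α F)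
    (hα : 0 < α) (hβ : 0 < β) (hb : 0 ≤ b) :
    IsGammaScaleMixture (α + β) fun s => F s * (1 + s * b) ^ (-β) := by
  obtain ⟨ν, hν, hν0, hνF⟩ := hF
  have := isProbabilityMeasureBeta hα hβ
  have hmeas : Measurable fun z : ℝ × ℝ => z.2 * z.1 + (1 - z.2) * b := by fun_prop
  have hae : ∀ᵐ z ∂ν.prod (betaMeasure α β), 0 ≤ z.2 * z.1 + (1 - z.2) * b := by
    have h1 : ∀ᵐ z ∂ν.prod (betaMeasure α β), 0 ≤ z.1 :=
      Measure.quasiMeasurePreserving_fst.ae hν0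
    have h2 : ∀ᵐ z ∂ν.prod (betaMeasure α β), z.2 ∈ Ioo (0 : ℝ) 1 :=
      Measure.quasiMeasurePreserving_snd.ae (ae_betaMeasure_mem_Ioo α β)
    filter_upwards [h1, h2] with z hz1 hz2
    have := sub_pos.2 hz2.2
    have := hz2.1
    positivity
  refine ⟨(ν.prod (betaMeasure α β)).map fun z => z.2 * z.1 + (1 - z.2) * b,
    Measure.isProbabilityMeasure_map hmeas.aemeasurable, ?_, fun s hs => ?_⟩
  · exact (ae_map_iff hmeas.aemeasurable measurableSet_Ici).2 hae
  · rw [integral_map hmeas.aemeasurable (Measurable.aestronglyMeasurable (by fun_prop)), integral_prod]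
    · simp only
      rw [← hνF s hs, ← integral_mul_const]
      refine integral_congr_ae (hν0.mono fun a ha => ?_)
      simp only
      rw [← integral_rpow_betaMeasure hα hβ (show 0 < 1 + s * a by positivity)
        (show 0 < 1 + s * b by positivity)]
      congr 1 with t
      congr 1
      ring
    · refine Integrable.of_bound (Measurable.aestronglyMeasurable (by fun_prop)) 1 (hae.mono fun z hz => ?_)
      have : 1 ≤ 1 + s * (z.2 * z.1 + (1 - z.2) * b) := by
        have := mul_nonneg hs hz
        linarith
      rw [Real.norm_of_nonneg (by positivity)]
      exact Real.rpow_neg_le_one (by positivity) this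

theorem isGammaScaleMixture_exp_neg_sum (S : Finset ℝ) (w : ℝ → ℝ) (hw : ∀ a ∈ S, 0 ≤ w a)
    (hS : ∀ a ∈ S, 0 ≤ a) (hpos : 0 < ∑ a ∈ S, w a) :
    IsGammaScaleMixture (∑ a ∈ S, w a)
      fun s => rexp (-∑ a ∈ S, w a * Real.log (1 + s * a)) := by
  classical
  have hexp {s a c : ℝ} (hs : 0 ≤ s) (ha : 0 ≤ a) :
      rexp (-(c * Real.log (1 + s * a))) = (1 + s * a) ^ (-c) := by
    rw [Real.rpow_def_of_pos (by positivity)]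
    congr 1
    ring
  have congr' {D : ℝ} {F G : ℝ → ℝ} (hF : IsGammaScaleMixture D F)
      (h : ∀ s, 0 ≤ s → F s = G s) : IsGammaScaleMixture D G := by
    obtain ⟨ν, h1, h2, h3⟩ := hF
    exact ⟨ν, h1, h2, fun s hs => (h3 s hs).trans (h s hs)⟩
  induction S using Finset.induction_on with
  | empty => simp at hpos
  | insert b S hb ih =>
    rw [Finset.sum_insert hb] at hpos ⊢
    simp only [Finset.sum_insert hb]
    have hwb := hw b (Finset.mem_insert_self b S)
    have hb0 := hS b (Finset.mem_insert_self b S)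
    have hw' : ∀ a ∈ S, 0 ≤ w a := fun a ha => hw a (Finset.mem_insert_of_mem ha)
    rcases hwb.eq_or_lt with h0 | h0
    · simp only [← h0, zero_add, zero_mul] at hpos ⊢
      exact ih hw' (fun a ha => hS a (Finset.mem_insert_of_mem ha)) hpos
    rcases (Finset.sum_nonneg hw').eq_or_lt with h1 | h1
    · have hz := (Finset.sum_eq_zero_iff_of_nonneg hw').1 h1.symm
      rw [← h1, add_zero]
      refine congr' (isGammaScaleMixture_rpow hb0) fun s hs => ?_
      rw [Finset.sum_eq_zero fun a ha => by rw [hz a ha, zero_mul], add_zero, hexp hs hb0]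
    · rw [add_comm]
      refine congr' ((ih hw' (fun a ha => hS a (Finset.mem_insert_of_mem ha)) h1).mul_rpow
        h1 h0 hb0) fun s hs => ?_
      rw [neg_add, Real.exp_add, hexp hs hb0, mul_comm]

/-- Kernel `w ↦ (1 + s (1 - w) / w) ^ (-D)`, extended continuously to `w = 0`. -/
noncomputable def gammaScaleKernel (D s w : ℝ) : ℝ := (w / (w + s * (1 - w))) ^ D

theorem gammaScaleKernel_eq {D s w : ℝ} (hs : 0 ≤ s) (hw : 0 < w) (hw1 : w ≤ 1) :
    gammaScaleKernel D s w = (1 + s * ((1 - w) / w)) ^ (-D) := by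
  have := sub_nonneg.2 hw1
  rw [gammaScaleKernel, Real.rpow_neg (by positivity), ← Real.inv_rpow (by positivity)]
  congr 1
  field_simp

theorem gammaScaleKernel_mem_Icc {D s w : ℝ} (hD : 0 < D) (hs : 0 ≤ s) (hw : 0 ≤ w)
    (hw1 : w ≤ 1) : gammaScaleKernel D s w ∈ Icc (0 : ℝ) 1 := by
  have := mul_nonneg hs (sub_nonneg.2 hw1)
  exact ⟨Real.rpow_nonneg (by positivity) _, Real.rpow_le_one (by positivity)
    (div_le_one_of_le₀ (by linarith) (by positivity)) hD.le⟩

theorem continuous_gammaScaleKernel {D s : ℝ} (hD : 0 < D) (hs : 0 < s) :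
    Continuous fun w : unitInterval => gammaScaleKernel D s w := by
  unfold gammaScaleKernel
  refine Continuous.rpow_const (Continuous.div (by fun_prop) (by fun_prop) fun w => ?_)
    fun w => Or.inr hD.le
  have h0 := w.2.1
  have h1 := sub_nonneg.2 w.2.2
  rcases h0.eq_or_lt with h | h
  · rw [← h]
    simpa using hs.ne'
  · positivity

theorem IsGammaScaleMixture.exists_unitInterval {D : ℝ} {F : ℝ → ℝ}
    (hF : IsGammaScaleMixture D F) :
    ∃ ρ : ProbabilityMeasure unitInterval,
      ∀ s : ℝ, 0 ≤ s → ∫ w : unitInterval, gammaScaleKernel D s w ∂ρ = F s := by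
  obtain ⟨ν, hν, hν0, hνF⟩ := hF
  let T : ℝ → unitInterval := fun a => projIcc 0 1 zero_le_one (1 / (1 + a))
  have hT : Measurable T := continuous_projIcc.measurable.comp (by fun_prop)
  refine ⟨⟨ν.map T, Measure.isProbabilityMeasure_map hT.aemeasurable⟩, fun s hs => ?_⟩
  rw [← hνF s hs, ProbabilityMeasure.coe_mk, integral_map hT.aemeasurable
    (Measurable.aestronglyMeasurable (by unfold gammaScaleKernel; fun_prop))]
  refine integral_congr_ae (hν0.mono fun a ha => ?_)
  have h1 : (T a : ℝ) = 1 / (1 + a) := by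
    simp only [T]
    rw [projIcc_of_mem zero_le_one
      ⟨by positivity, div_le_one_of_le₀ (by linarith) (by positivity)⟩]
  simp only [h1]
  rw [gammaScaleKernel_eq hs (by positivity) (div_le_one_of_le₀ (by linarith) (by positivity))]
  congr 3
  field_simp
  ring

theorem isGammaScaleMixture_of_unitInterval {D : ℝ} {F : ℝ → ℝ} (hD : 0 < D)
    (ρ : ProbabilityMeasure unitInterval)
    (hρ : ∀ s : ℝ, 0 < s → ∫ w : unitInterval, gammaScaleKernel D s w ∂ρ = F s)
    (hF0 : F 0 = 1) (hlim : Tendsto (fun n : ℕ => F (1 / ((n : ℝ) + 1))) atTop (𝓝 1)) :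
    IsGammaScaleMixture D F := by
  have hlim2 : Tendsto
      (fun n : ℕ => ∫ w : unitInterval, gammaScaleKernel D (1 / ((n : ℝ) + 1)) w ∂ρ) atTop
      (𝓝 (∫ w : unitInterval, ({0}ᶜ : Set unitInterval).indicator (fun _ => (1 : ℝ)) w ∂ρ)) := by
    refine tendsto_integral_of_dominated_convergence (fun _ => 1)
      (fun n => (continuous_gammaScaleKernel hD (by positivity)).aestronglyMeasurable)
      (integrable_const _) (fun n => ae_of_all _ fun w => ?_) (ae_of_all _ fun w => ?_)
    · have := gammaScaleKernel_mem_Icc (s := 1 / ((n : ℝ) + 1)) hD (by positivity) w.2.1 w.2.2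
      rw [Real.norm_of_nonneg this.1]
      exact this.2
    · by_cases hw : w = 0
      · simp [hw, gammaScaleKernel, Real.zero_rpow hD.ne']
      · rw [indicator_of_mem (by simpa using hw)]
        have hw0 : (w : ℝ) ≠ 0 := fun h => hw (Subtype.ext h)
        have h := (((tendsto_one_div_add_atTop_nhds_zero_nat (𝕜 := ℝ)).mul_const
          (1 - (w : ℝ))).const_add (w : ℝ))
        have h2 := ((tendsto_const_nhds (x := (w : ℝ))).div h (by simpa using hw0)).rpow_const
          (p := D) (Or.inr hD.le)
        simpa [gammaScaleKernel, hw0] using h2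
  rw [integral_indicator (by measurability)] at hlim2
  have hlim3 := tendsto_nhds_unique (hlim2.congr fun n => hρ _ (by positivity)) hlim
  have hne : ∀ᵐ w ∂(ρ : Measure unitInterval), w ≠ 0 := by
    have h1 : (ρ : Measure unitInterval).real {0}ᶜ = 1 := by simpa using hlim3
    rw [probReal_compl_eq_one_sub (by measurability)] at h1
    have h2 : (ρ : Measure unitInterval).real {0} = 0 := by linarith
    rw [ae_iff]
    simpa [measureReal_eq_zero_iff] using h2
  have hT : Measurable fun w : unitInterval => (1 - (w : ℝ)) / w := by fun_prop
  refine ⟨(ρ : Measure unitInterval).map fun w : unitInterval => (1 - (w : ℝ)) / w,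
    Measure.isProbabilityMeasure_map hT.aemeasurable, ?_, fun s hs => ?_⟩
  · refine (ae_map_iff hT.aemeasurable measurableSet_Ici).2 (ae_of_all _ fun w => ?_)
    exact div_nonneg (sub_nonneg.2 w.2.2) w.2.1
  · rw [integral_map hT.aemeasurable (Measurable.aestronglyMeasurable (by fun_prop))]
    rcases hs.eq_or_lt with h | h
    · simp [← h, hF0]
    · rw [← hρ s h]
      refine integral_congr_ae (hne.mono fun w hw => ?_)
      have hw0 : 0 < (w : ℝ) := lt_of_le_of_ne w.2.1 fun h => hw (Subtype.ext h.symm)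
      exact (gammaScaleKernel_eq hs hw0 w.2.2).symm

theorem isGammaScaleMixture_of_tendsto {D : ℝ} {F : ℝ → ℝ} {G : ℕ → ℝ → ℝ} (hD : 0 < D)
    (hG : ∀ n, IsGammaScaleMixture D (G n))
    (hGF : ∀ s : ℝ, 0 ≤ s → Tendsto (fun n => G n s) atTop (𝓝 (F s)))
    (hF0 : F 0 = 1) (hlim : Tendsto (fun n : ℕ => F (1 / ((n : ℝ) + 1))) atTop (𝓝 1)) :
    IsGammaScaleMixture D F := by
  choose ρ hρ using fun n => (hG n).exists_unitInterval
  obtain ⟨σ, φ, hφ, hσ⟩ := CompactSpace.tendsto_subseq ρ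
  refine isGammaScaleMixture_of_unitInterval hD σ (fun s hs => ?_) hF0 hlim
  have h := ProbabilityMeasure.tendsto_iff_forall_integral_tendsto.1 hσ
    (BoundedContinuousFunction.mkOfCompact ⟨_, continuous_gammaScaleKernel hD hs⟩)
  refine tendsto_nhds_unique h (((hGF s hs.le).comp hφ.tendsto_atTop).congr fun n => ?_)
  exact (hρ (φ n) s hs.le).symm

theorem isGammaScaleMixture_exp_neg_integral (m : Measure ℝ) [IsFiniteMeasure m] {g : ℝ → ℝ}
    (hg : Measurable g) (hg0 : ∀ u, 0 ≤ g u) (hpos : 0 < m.real univ)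
    (hint : ∀ s : ℝ, 0 ≤ s → Integrable (fun u => Real.log (1 + s * g u)) m)
    (hlim : Tendsto (fun n : ℕ =>
      rexp (-∫ u, Real.log (1 + 1 / ((n : ℝ) + 1) * g u) ∂m)) atTop (𝓝 1)) :
    IsGammaScaleMixture (m.real univ) fun s => rexp (-∫ u, Real.log (1 + s * g u) ∂m) := by
  have h0 : (0 : ℝ) ∈ Ici (0 : ℝ) := self_mem_Ici
  let f : ℕ → SimpleFunc ℝ ℝ := SimpleFunc.approxOn g hg (Ici 0) 0 h0
  have hf0 (n : ℕ) (u : ℝ) : 0 ≤ f n u := SimpleFunc.approxOn_mem hg h0 n u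
  have hfle (n : ℕ) (u : ℝ) : f n u ≤ 2 * g u := by
    have := SimpleFunc.norm_approxOn_zero_le hg h0 u n
    rw [Real.norm_of_nonneg (hg0 u), ← two_mul] at this
    exact (le_abs_self _).trans this
  have hG (n : ℕ) : IsGammaScaleMixture (m.real univ)
      fun s => rexp (-∫ u, Real.log (1 + s * f n u) ∂m) := by
    have hsum : ∑ a ∈ (f n).range, m.real (f n ⁻¹' {a}) = m.real univ := by
      rw [sum_measureReal_preimage_singleton _ fun a _ => (f n).measurableSet_fiber a]
      congr 1
      ext u
      simp
    have hI (s : ℝ) : ∫ u, Real.log (1 + s * f n u) ∂m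
        = ∑ a ∈ (f n).range, m.real (f n ⁻¹' {a}) * Real.log (1 + s * a) := by
      have hi : Integrable (f n) m := SimpleFunc.integrable_of_isFiniteMeasure _
      have := SimpleFunc.map_integral (f n) (fun a => Real.log (1 + s * a)) hi (by simp)
      rw [SimpleFunc.integral_eq_integral _ (SimpleFunc.integrable_of_isFiniteMeasure _)] at this
      simpa using this
    simp only [hI]
    rw [← hsum] at hpos ⊢
    refine isGammaScaleMixture_exp_neg_sum _ _ (fun _ _ => measureReal_nonneg) (fun a ha => ?_)
      hpos
    obtain ⟨u, rfl⟩ := SimpleFunc.mem_range.1 ha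
    exact hf0 n u
  refine isGammaScaleMixture_of_tendsto hpos hG (fun s hs => ?_) (by simp) hlim
  refine (Real.continuous_exp.tendsto _).comp (Tendsto.neg ?_)
  refine tendsto_integral_of_dominated_convergence (fun u => Real.log (1 + (2 * s) * g u))
    (fun n => Measurable.aestronglyMeasurable (by have := (f n).measurable; fun_prop))
    (hint _ (by positivity)) (fun n => ae_of_all _ fun u => ?_) (ae_of_all _ fun u => ?_)
  · have h1 := mul_nonneg hs (hf0 n u)
    have h2 := mul_le_mul_of_nonneg_left (hfle n u) hs
    rw [Real.norm_of_nonneg (Real.log_nonneg (by linarith))]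
    exact Real.log_le_log (by linarith) (by linarith)
  · have h1 : Tendsto (fun n => f n u) atTop (𝓝 (g u)) :=
      SimpleFunc.tendsto_approxOn hg h0 (subset_closure (hg0 u))
    refine ((h1.const_mul s).const_add 1).log ?_
    have := mul_nonneg hs (hg0 u)
    positivity

theorem integral_exp_neg_map_mul_gammaMeasure {D s : ℝ} (hD : 0 < D) (hs : 0 ≤ s)
    (ν : Measure ℝ) [IsProbabilityMeasure ν] (hν : ∀ᵐ a ∂ν, 0 ≤ a) :
    ∫ x, rexp (-(s * x)) ∂(ν.prod (gammaMeasure D 1)).map (fun p : ℝ × ℝ => p.1 * p.2)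
      = ∫ a, (1 + s * a) ^ (-D) ∂ν := by
  have := isProbabilityMeasure_gammaMeasure hD one_pos
  rw [integral_map (by fun_prop) (by fun_prop), integral_prod]
  · refine integral_congr_ae (hν.mono fun a ha => ?_)
    simp only [← mul_assoc]
    exact integral_exp_neg_mul_gammaMeasure_s17 hD (mul_nonneg hs ha)
  · have h1 : ∀ᵐ z ∂ν.prod (gammaMeasure D 1), 0 ≤ z.1 :=
      Measure.quasiMeasurePreserving_fst.ae hν
    have h2 : ∀ᵐ z ∂ν.prod (gammaMeasure D 1), 0 ≤ z.2 :=
      Measure.quasiMeasurePreserving_snd.ae (ae_gammaMeasure_nonneg D 1)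
    refine Integrable.of_bound (by fun_prop) 1 ?_
    filter_upwards [h1, h2] with z hz1 hz2
    rw [Real.norm_of_nonneg (Real.exp_pos _).le, Real.exp_le_one_iff]
    have := mul_nonneg hs (mul_nonneg hz1 hz2)
    linarith

/-- Gamma variance-mixture representation of a GGC with finite positive Thorin mass `D`:
there is a nonnegative mixing law `ν` (the law of a shadowing variable `A` independent of
`Z ~ Gamma(D,1)`) such that `X` has the same distribution as `A·Z`. -/
theorem ggc_gamma_mixture_representation {Ω : Type*} [MeasurableSpace Ω]
    (P : Measure Ω) [IsProbabilityMeasure P] (X : Ω → ℝ) (hX : Measurable X)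
    (μ : Measure ℝ) (hGGC : IsGGC P X μ)
    (hfin : μ (Set.Ioi (0:ℝ)) ≠ ⊤)
    (D : ℝ) (hD : D = (μ (Set.Ioi (0:ℝ))).toReal) (hDpos : 0 < D) :
    ∃ ν : Measure ℝ, IsProbabilityMeasure ν ∧ ν (Set.Iio 0) = 0 ∧
      Measure.map X P =
        Measure.map (fun p : ℝ × ℝ => p.1 * p.2) (ν.prod (gammaMeasure D 1)) := by
  obtain ⟨hX0, hint, hlap⟩ := hGGC
  have : IsFiniteMeasure (μ.restrict (Ioi 0)) := ⟨by simpa using hfin.lt_top⟩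
  have hmass : (μ.restrict (Ioi 0)).real univ = D := by simp [hD, measureReal_def]
  have habs {u : ℝ} (hu : u ∈ Ioi (0 : ℝ)) : |u⁻¹| = u⁻¹ := abs_of_pos (inv_pos.2 hu)
  have hlog (s : ℝ) : ∫ u in Ioi (0 : ℝ), Real.log (1 + s * |u⁻¹|) ∂μ
      = ∫ u in Ioi (0 : ℝ), Real.log (1 + s / u) ∂μ :=
    setIntegral_congr_fun measurableSet_Ioi fun u hu => by
      simp only [habs hu, div_eq_mul_inv]
  obtain ⟨ν, hν, hν0, hνF⟩ := isGammaScaleMixture_exp_neg_integral (μ.restrict (Ioi 0))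
    (g := fun u => |u⁻¹|) (by fun_prop) (fun u => abs_nonneg _) (hmass ▸ hDpos)
    (fun s hs => (hint s hs).congr_fun (fun u hu => by
      simp only [habs hu, div_eq_mul_inv]) measurableSet_Ioi) (by
      simp only [hlog]
      have h : Tendsto (fun n : ℕ => ∫ ω, rexp (-(1 / ((n : ℝ) + 1) * X ω)) ∂P) atTop
          (𝓝 (∫ _, 1 ∂P)) := by
        refine tendsto_integral_of_dominated_convergence (fun _ => 1)
          (fun n => Measurable.aestronglyMeasurable (by fun_prop)) (integrable_const _)
          (fun n => ae_of_all _ fun ω => ?_) (ae_of_all _ fun ω => ?_)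
        · rw [Real.norm_of_nonneg (Real.exp_pos _).le, Real.exp_le_one_iff]
          have := hX0 ω
          simp only [Left.neg_nonpos_iff]
          positivity
        · have h1 := ((tendsto_one_div_add_atTop_nhds_zero_nat (𝕜 := ℝ)).mul_const (X ω)).neg
          simpa [Function.comp_def] using (Real.continuous_exp.tendsto _).comp h1
      rw [integral_const, probReal_univ, one_smul] at h
      exact h.congr fun n => hlap _ (by positivity))
  rw [hmass] at hνF
  beta_reduce at hνF
  refine ⟨ν, hν, ?_, ?_⟩
  · simpa [ae_iff, Iio] using hν0
  · have := isProbabilityMeasure_gammaMeasure hDpos one_pos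
    have := Measure.isProbabilityMeasure_map (μ := P) hX.aemeasurable
    refine Real.measure_ext_of_integral_exp_neg
      ((ae_map_iff hX.aemeasurable measurableSet_Ici).2 (ae_of_all _ hX0)) ?_ fun n => ?_
    · refine (ae_map_iff (by fun_prop) measurableSet_Ici).2 ?_
      filter_upwards [Measure.quasiMeasurePreserving_fst.ae hν0,
        Measure.quasiMeasurePreserving_snd.ae (ae_gammaMeasure_nonneg D 1)] with z hz1 hz2
      exact mul_nonneg hz1 hz2
    · rw [integral_map hX.aemeasurable (by fun_prop), hlap n (by positivity), ← hlog,
        ← hνF n (by positivity),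
        integral_exp_neg_map_mul_gammaMeasure hDpos (by positivity) ν hν0]
end
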